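/- arXiv:1012.0682 — 10 statements merged into one kernel-verified Lean document; each statement's English description precedes it below -/
import Mathlib

section
/- Let (w, u, v) be a classical solution of system (S) with positive data. Then the solution is uniformly bounded: there exists a constant M > 0 such that w(t) ≤ M, v(t) ≤ M, and u(x,t) ≤ M for all t ≥ 0 and all x ∈ [0, x*]. -/
lemma aux_left_deriv_nonneg (f : ℝ → ℝ) (b t : ℝ) (ht : 0 < t) (hf : HasDerivAt f b t)
    (hm : ∀ s, 0 ≤ s → s < t → f s ≤ f t) : 0 ≤ b := by
  have h1 : Filter.Tendsto (slope f t) (nhdsWithin t (Set.Iio t)) (nhds b) :=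
    (hasDerivAt_iff_tendsto_slope.1 hf).mono_left
      (nhdsWithin_mono t (fun s hs => ne_of_lt hs))
  refine ge_of_tendsto h1 ?_
  have h2 : Set.Ioo 0 t ∈ nhdsWithin t (Set.Iio t) := Ioo_mem_nhdsLT ht
  filter_upwards [h2] with s hs
  rw [slope_def_field]
  exact div_nonneg_of_nonpos (by linarith [hm s hs.1.le hs.2]) (by linarith [hs.2])

lemma aux_barrier (f f' : ℝ → ℝ) (c : ℝ) (hc : ContinuousOn f (Set.Ici 0))
    (hd : ∀ t > (0:ℝ), HasDerivAt f (f' t) t) (h0 : c < f 0)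
    (hb : ∀ t > (0:ℝ), f t = c → 0 < f' t) : ∀ t ≥ (0:ℝ), c < f t := by
  intro T hT
  by_contra hcon
  push Not at hcon
  -- first hitting time
  have hclosed : IsCompact (Set.Icc 0 T ∩ f ⁻¹' (Set.Iic c)) := by
    refine IsCompact.of_isClosed_subset (isCompact_Icc (a := (0:ℝ)) (b := T)) ?_ Set.inter_subset_left
    exact (hc.mono Set.Icc_subset_Ici_self).preimage_isClosed_of_isClosed isClosed_Icc isClosed_Iic
  obtain ⟨t, ⟨⟨ht0, htT⟩, htc⟩, hmin⟩ := hclosed.exists_isLeast ⟨T, ⟨hT, le_rfl⟩, hcon⟩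
  have htc : f t ≤ c := htc
  have htpos : 0 < t := by
    rcases ht0.eq_or_lt with h | h
    · subst h; linarith
    · exact h
  have hbefore : ∀ s, 0 ≤ s → s < t → c < f s := by
    intro s hs hst
    by_contra hh
    push Not at hh
    have := hmin ⟨⟨hs, by linarith⟩, hh⟩
    linarith
  have hge : c ≤ f t := by
    have h1 : Filter.Tendsto f (nhdsWithin t (Set.Iio t)) (nhds (f t)) :=
      (hd t htpos).continuousAt.tendsto.mono_left nhdsWithin_le_nhds
    refine ge_of_tendsto h1 ?_
    filter_upwards [Ioo_mem_nhdsLT htpos] with s hs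
    exact (hbefore s hs.1.le hs.2).le
  have heq : f t = c := le_antisymm htc hge
  have h2 := aux_left_deriv_nonneg (fun s => - f s) (- f' t) t htpos (hd t htpos).neg
    (fun s hs hst => by have := hbefore s hs hst; linarith)
  linarith [hb t htpos heq]

lemma aux_maxprinciple (X C : ℝ) (hX : 0 < X) (F : ℝ → ℝ → ℝ)
    (hF : ContinuousOn (fun q : ℝ × ℝ => F q.1 q.2) (Set.Icc 0 X ×ˢ Set.Ici 0))
    (hd : ∀ t > (0:ℝ), ∀ x ∈ Set.Ioo 0 X, ∃ a b k : ℝ, HasDerivAt (fun y => F y t) a x ∧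
      HasDerivAt (fun s => F x s) b t ∧ 0 ≤ k ∧ b + k * a < 0)
    (h0 : ∀ x ∈ Set.Icc 0 X, F x 0 ≤ C) (h1 : ∀ t ≥ (0:ℝ), F 0 t ≤ C) :
    ∀ t ≥ (0:ℝ), ∀ x ∈ Set.Icc 0 X, F x t ≤ C := by
  have key : ∀ t ≥ (0:ℝ), ∀ x ∈ Set.Ico 0 X, F x t ≤ C := by
    intro T hT B hB
    have hcpt : IsCompact (Set.Icc 0 B ×ˢ Set.Icc 0 T) := isCompact_Icc.prod isCompact_Icc
    obtain ⟨⟨x, t⟩, ⟨hx, ht⟩, hmax⟩ := hcpt.exists_isMaxOn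
      ⟨(B, T), ⟨hB.1, le_rfl⟩, ⟨hT, le_rfl⟩⟩
      (hF.mono (Set.prod_mono (Set.Icc_subset_Icc_right hB.2.le) Set.Icc_subset_Ici_self))
    have hmax' : ∀ y s, y ∈ Set.Icc 0 B → s ∈ Set.Icc 0 T → F y s ≤ F x t :=
      fun y s hy hs => hmax (show (y, s) ∈ Set.Icc 0 B ×ˢ Set.Icc 0 T from ⟨hy, hs⟩)
    simp only at hx ht
    refine (hmax' B T ⟨hB.1, le_rfl⟩ ⟨hT, le_rfl⟩).trans ?_
    rcases hx.1.eq_or_lt with hx0 | hx0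
    · rw [← hx0]; exact h1 t ht.1
    rcases ht.1.eq_or_lt with ht0 | ht0
    · rw [← ht0]; exact h0 x ⟨hx.1, by linarith [hx.2, hB.2]⟩
    exfalso
    obtain ⟨a, b, k, ha, hb, hk, hlt⟩ := hd t ht0 x ⟨hx0, by linarith [hx.2, hB.2]⟩
    have ha0 := aux_left_deriv_nonneg _ _ _ hx0 ha
      (fun s hs hst => hmax' s t ⟨hs, by linarith [hx.2]⟩ ht)
    have hb0 := aux_left_deriv_nonneg _ _ _ ht0 hb
      (fun s hs hst => hmax' x s hx ⟨hs, by linarith [ht.2]⟩)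
    nlinarith [mul_nonneg hk ha0]
  intro t ht x hx
  rcases hx.2.eq_or_lt with h | h
  · subst h
    have hc : ContinuousOn (fun y => F y t) (Set.Icc 0 x) :=
      hF.comp (f := fun y : ℝ => (y, t)) (by fun_prop) (fun y hy => ⟨hy, ht⟩)
    have h2 : Filter.Tendsto (fun y => F y t) (nhdsWithin x (Set.Ioo 0 x)) (nhds (F x t)) :=
      (hc x hx).tendsto.mono_left (nhdsWithin_mono _ Set.Ioo_subset_Icc_self)
    have : (nhdsWithin x (Set.Ioo 0 x)).NeBot := right_nhdsWithin_Ioo_neBot hX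
    refine le_of_tendsto h2 ?_
    filter_upwards [self_mem_nhdsWithin] with y hy
    exact key t ht y ⟨hy.1.le, hy.2⟩
  · exact key t ht x ⟨hx.1, h⟩

theorem uniform_boundedness
    (xstar mu : ℝ) (hxstar : 0 < xstar) (hmu : 0 < mu)
    (α : ℝ → ℝ) (g : ℝ → ℝ → ℝ) (p : ℝ → ℝ)
    (αinf α0 : ℝ) (hαinf : αinf < 0)
    (hαcont : ContinuousOn α (Set.Ici 0))
    (hαanti : StrictAntiOn α (Set.Ici 0))
    (hαrange : ∀ s ∈ Set.Ici (0:ℝ), α s ∈ Set.Icc αinf α0)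
    (hαlim : Filter.Tendsto α Filter.atTop (nhds αinf))
    (hpC1 : ContDiffOn ℝ 1 p (Set.Icc 0 xstar))
    (hgC2 : ∀ s ∈ Set.Ici (0:ℝ), ContDiffOn ℝ 2 (fun x => g x s) (Set.Icc 0 xstar))
    (Kg : ℝ)
    (hgderivbdd : ∀ x ∈ Set.Icc 0 xstar, ∀ s ∈ Set.Ici (0:ℝ),
      |deriv (fun y => g y s) x| ≤ Kg ∧ |deriv (deriv (fun y => g y s)) x| ≤ Kg)
    (gm gp : ℝ) (hgm : 0 < gm)
    (hgbound : ∀ x ∈ Set.Icc 0 xstar, ∀ s ∈ Set.Ici (0:ℝ), g x s ∈ Set.Icc gm gp)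
    (w v : ℝ → ℝ) (u : ℝ → ℝ → ℝ)
    (hwC1 : ContDiffOn ℝ 1 w (Set.Ici 0))
    (hvC1 : ContDiffOn ℝ 1 v (Set.Ici 0))
    (huC1 : ContDiffOn ℝ 1 (fun q : ℝ × ℝ => u q.1 q.2) (Set.Icc 0 xstar ×ˢ Set.Ici 0))
    (hu0C1 : ContDiffOn ℝ 1 (fun x => u x 0) (Set.Icc 0 xstar))
    (hweq : ∀ t > (0:ℝ), HasDerivAt w (α (v t) * w t) t)
    (hueq : ∀ t > (0:ℝ), ∀ x ∈ Set.Ioo 0 xstar,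
      deriv (fun s => u x s) t + deriv (fun y => g y (v t) * u y t) x = p x * u x t)
    (hbc : ∀ t ≥ (0:ℝ), u 0 t = w t)
    (hveq : ∀ t > (0:ℝ), HasDerivAt v (g xstar (v t) * u xstar t - mu * v t) t)
    (hw0 : 0 < w 0) (hv0 : 0 < v 0)
    (hu0pos : ∀ x ∈ Set.Icc 0 xstar, 0 < u x 0)
    (hupos : ∀ x ∈ Set.Icc 0 xstar, ∀ t ≥ (0:ℝ), 0 < u x t)
    :
    ∃ M > (0:ℝ), ∀ t ≥ (0:ℝ),
      w t ≤ M ∧ v t ≤ M ∧ ∀ x ∈ Set.Icc 0 xstar, u x t ≤ M := by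
  have hIX : (0:ℝ) ∈ Set.Icc 0 xstar := ⟨le_rfl, hxstar.le⟩
  have hXX : xstar ∈ Set.Icc 0 xstar := ⟨hxstar.le, le_rfl⟩
  have hwpos : ∀ t ≥ (0:ℝ), 0 < w t := fun t ht => by
    rw [← hbc t ht]; exact hupos 0 hIX t ht
  have hwc := hwC1.continuousOn
  have hvc := hvC1.continuousOn
  have huc := huC1.continuousOn
  have hvpos : ∀ t ≥ (0:ℝ), 0 < v t := by
    refine aux_barrier v _ 0 hvc hveq hv0 ?_
    intro t ht h
    rw [h]
    have h1 := (hgbound xstar hXX 0 (Set.mem_Ici.2 le_rfl)).1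
    have h2 := mul_pos (lt_of_lt_of_le hgm h1) (hupos xstar hXX t ht.le)
    linarith
  obtain ⟨P, hP⟩ := isCompact_Icc.exists_bound_of_continuousOn hpC1.continuousOn
  have hu0c : ContinuousOn (fun x => Real.log (u x 0) - Real.log (w 0)) (Set.Icc 0 xstar) :=
    (hu0C1.continuousOn.log (fun x hx => (hu0pos x hx).ne')).sub continuousOn_const
  obtain ⟨C0, hC0⟩ := isCompact_Icc.exists_bound_of_continuousOn hu0c
  simp only [Real.norm_eq_abs] at hP hC0
  have hC0nn : 0 ≤ C0 := (abs_nonneg _).trans (hC0 0 hIX)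
  set K := P + Kg + |αinf| + |α0| with hK
  have hKnn : 0 ≤ K := by
    have h1 := (abs_nonneg _).trans (hP 0 hIX)
    have h2 := (abs_nonneg _).trans (hgderivbdd 0 hIX 0 (Set.mem_Ici.2 le_rfl)).1
    have := abs_nonneg αinf
    have := abs_nonneg α0
    linarith
  set lam := (K + 1) / gm with hlam
  have hlampos : 0 < lam := by positivity
  have hlamgm : gm * lam = K + 1 := by rw [hlam]; field_simp
  have hαb : ∀ t ≥ (0:ℝ), |α (v t)| ≤ |αinf| + |α0| := fun t ht => by
    have h := hαrange (v t) (hvpos t ht).le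
    rw [abs_le]
    constructor
    · linarith [h.1, neg_abs_le αinf, abs_nonneg α0]
    · linarith [h.2, le_abs_self α0, abs_nonneg αinf]
  -- continuity of the logarithms
  have hlu : ContinuousOn (fun q : ℝ × ℝ => Real.log (u q.1 q.2)) (Set.Icc 0 xstar ×ˢ Set.Ici 0) :=
    huc.log (fun q hq => (hupos q.1 hq.1 q.2 hq.2).ne')
  have hlw : ContinuousOn (fun q : ℝ × ℝ => Real.log (w q.2)) (Set.Icc 0 xstar ×ˢ Set.Ici 0) :=
    (hwc.log (fun t ht => (hwpos t ht).ne')).comp (f := fun q : ℝ × ℝ => q.2) (by fun_prop)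
      (fun q hq => hq.2)
  -- the pointwise derivative information
  have hpt : ∀ t > (0:ℝ), ∀ x ∈ Set.Ioo 0 xstar, ∃ ux ut : ℝ,
      HasDerivAt (fun y => Real.log (u y t)) ux x ∧
      HasDerivAt (fun s => Real.log (u x s) - Real.log (w s)) ut t ∧
      |ut + g x (v t) * ux| ≤ K := by
    intro t ht x hx
    have hxI := Set.Ioo_subset_Icc_self hx
    have hup := hupos x hxI t ht.le
    have hwp := hwpos t ht.le
    have hnb : Set.Icc 0 xstar ×ˢ Set.Ici (0:ℝ) ∈ nhds (x, t) :=
      prod_mem_nhds (Icc_mem_nhds hx.1 hx.2) (Ici_mem_nhds ht)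
    have hdu : DifferentiableAt ℝ (fun q : ℝ × ℝ => u q.1 q.2) (x, t) :=
      (huC1.contDiffAt hnb).differentiableAt (by norm_num)
    have hdx : DifferentiableAt ℝ (fun y => u y t) x :=
      DifferentiableAt.comp (f := fun y : ℝ => (y, t)) (g := fun q : ℝ × ℝ => u q.1 q.2) x hdu
        (by fun_prop)
    have hdt : DifferentiableAt ℝ (fun s => u x s) t :=
      DifferentiableAt.comp (f := fun s : ℝ => (x, s)) (g := fun q : ℝ × ℝ => u q.1 q.2) t hdu
        (by fun_prop)
    have hvt : v t ∈ Set.Ici (0:ℝ) := (hvpos t ht.le).le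
    have hdg : DifferentiableAt ℝ (fun y => g y (v t)) x :=
      ((hgC2 (v t) hvt).contDiffAt (Icc_mem_nhds hx.1 hx.2)).differentiableAt (by norm_num)
    have hpde := hueq t ht x hx
    have hprod := (hdg.hasDerivAt.mul hdx.hasDerivAt).deriv
    have hprod' : deriv (fun y => g y (v t) * u y t) x
      = deriv (fun y => g y (v t)) x * u x t + g x (v t) * deriv (fun y => u y t) x := hprod
    rw [hprod'] at hpde
    refine ⟨_, _, hdx.hasDerivAt.log hup.ne',
      (hdt.hasDerivAt.log hup.ne').sub ((hweq t ht).log hwp.ne'), ?_⟩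
    have he : deriv (fun s => u x s) t / u x t - α (v t) * w t / w t
        + g x (v t) * (deriv (fun y => u y t) x / u x t)
        = p x - deriv (fun y => g y (v t)) x - α (v t) := by
      field_simp
      linarith
    rw [he]
    have h1 := abs_le.1 (hP x hxI)
    have h2 := abs_le.1 (hgderivbdd x hxI (v t) hvt).1
    have h3 := abs_le.1 (hαb t ht.le)
    rw [abs_le]
    constructor <;> linarith [h1.1, h1.2, h2.1, h2.2, h3.1, h3.2]
  have hup : ∀ t ≥ (0:ℝ), ∀ x ∈ Set.Icc 0 xstar,
      Real.log (u x t) - Real.log (w t) - lam * x ≤ C0 := by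
    refine aux_maxprinciple xstar C0 hxstar
      (fun x t => Real.log (u x t) - Real.log (w t) - lam * x) ?_ ?_ ?_ ?_
    · exact (hlu.sub hlw).sub (by fun_prop)
    · intro t ht x hx
      obtain ⟨ux, ut, h1, h2, h3⟩ := hpt t ht x hx
      have hg := (hgbound x (Set.Ioo_subset_Icc_self hx) (v t) (hvpos t ht.le).le).1
      refine ⟨ux - lam, ut, g x (v t), ?_, ?_, by linarith, ?_⟩
      · have := (h1.sub_const (Real.log (w t))).sub ((hasDerivAt_id x).const_mul lam)
        rw [mul_one] at this
        exact this
      · exact h2.sub_const _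
      · have := (abs_le.1 h3).2
        nlinarith [mul_le_mul_of_nonneg_right hg hlampos.le]
    · intro x hx
      have := (abs_le.1 (hC0 x hx)).2
      have := mul_nonneg hlampos.le hx.1
      linarith
    · intro t ht
      simp only [hbc t ht]
      linarith
  have hlow : ∀ t ≥ (0:ℝ), ∀ x ∈ Set.Icc 0 xstar,
      -(Real.log (u x t) - Real.log (w t)) - lam * x ≤ C0 := by
    refine aux_maxprinciple xstar C0 hxstar
      (fun x t => -(Real.log (u x t) - Real.log (w t)) - lam * x) ?_ ?_ ?_ ?_
    · exact (hlu.sub hlw).neg.sub (by fun_prop)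
    · intro t ht x hx
      obtain ⟨ux, ut, h1, h2, h3⟩ := hpt t ht x hx
      have hg := (hgbound x (Set.Ioo_subset_Icc_self hx) (v t) (hvpos t ht.le).le).1
      refine ⟨-ux - lam, -ut, g x (v t), ?_, ?_, by linarith, ?_⟩
      · have := (h1.sub_const (Real.log (w t))).neg.sub ((hasDerivAt_id x).const_mul lam)
        rw [mul_one] at this
        exact this
      · exact h2.neg.sub_const _
      · have := (abs_le.1 h3).1
        nlinarith [mul_le_mul_of_nonneg_right hg hlampos.le]
    · intro x hx
      have := (abs_le.1 (hC0 x hx)).1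
      have := mul_nonneg hlampos.le hx.1
      linarith
    · intro t ht
      simp only [hbc t ht]
      linarith
  set E := Real.exp (C0 + lam * xstar) with hE
  have hEpos : 0 < E := Real.exp_pos _
  have huE : ∀ t ≥ (0:ℝ), ∀ x ∈ Set.Icc 0 xstar, u x t ≤ E * w t := by
    intro t ht x hx
    have h := hup t ht x hx
    have := mul_le_mul_of_nonneg_left hx.2 hlampos.le
    rw [← Real.log_le_log_iff (hupos x hx t ht) (mul_pos hEpos (hwpos t ht)),
      Real.log_mul hEpos.ne' (hwpos t ht).ne', hE, Real.log_exp]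
    linarith
  have hwE : ∀ t ≥ (0:ℝ), w t ≤ E * u xstar t := by
    intro t ht
    have h := hlow t ht xstar hXX
    rw [← Real.log_le_log_iff (hwpos t ht) (mul_pos hEpos (hupos xstar hXX t ht)),
      Real.log_mul hEpos.ne' (hupos xstar hXX t ht).ne', hE, Real.log_exp]
    linarith
  -- v dominates a multiple of w
  obtain ⟨r, hr, hrv, hrs⟩ : ∃ r > (0:ℝ), r * w 0 < v 0 ∧ r * (E * (mu + |α0|)) < gm := by
    have hD : 0 < E * (mu + |α0|) := by positivity
    refine ⟨min (v 0 / w 0 / 2) (gm / (E * (mu + |α0|)) / 2), by positivity, ?_, ?_⟩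
    · calc _ ≤ v 0 / w 0 / 2 * w 0 := by gcongr; exact min_le_left _ _
        _ = v 0 / 2 := by field_simp
        _ < v 0 := by linarith
    · calc _ ≤ gm / (E * (mu + |α0|)) / 2 * (E * (mu + |α0|)) := by gcongr; exact min_le_right _ _
        _ = gm / 2 := by field_simp
        _ < gm := by linarith
  have hvw : ∀ t ≥ (0:ℝ), 0 < v t - r * w t := by
    refine aux_barrier (fun t => v t - r * w t) _ 0 (hvc.sub (continuousOn_const.mul hwc))
      (fun t ht => (hveq t ht).sub ((hweq t ht).const_mul r)) (by linarith) ?_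
    intro t ht h
    have hvt : v t = r * w t := by linarith
    have hg := (hgbound xstar hXX (v t) (hvpos t ht.le).le).1
    have hα := (hαrange (v t) (hvpos t ht.le).le).2
    have hw := hwpos t ht.le
    have hu := hupos xstar hXX t ht.le
    have e1 : gm * u xstar t ≤ g xstar (v t) * u xstar t := mul_le_mul_of_nonneg_right hg hu.le
    have e2 : r * (α (v t) * w t) ≤ r * (|α0| * w t) := by
      gcongr
      exact hα.trans (le_abs_self _)
    have e3 : r * (mu + |α0|) * w t ≤ r * (mu + |α0|) * (E * u xstar t) := by
      gcongr
      exact hwE t ht.le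
    have e4 : r * (E * (mu + |α0|)) * u xstar t < gm * u xstar t := mul_lt_mul_of_pos_right hrs hu
    have e5 : mu * v t = r * mu * w t := by rw [hvt]; ring
    rw [e5]
    linarith
  -- w bounded
  obtain ⟨S, hS0, hS⟩ : ∃ S ≥ (0:ℝ), ∀ s ≥ S, α s < 0 := by
    obtain ⟨S, hS⟩ := Filter.eventually_atTop.1 (hαlim.eventually (gt_mem_nhds hαinf))
    exact ⟨max S 0, le_max_right _ _, fun s hs => hS s ((le_max_left _ _).trans hs)⟩
  obtain ⟨M1, hM1, hM1S⟩ : ∃ M1, w 0 < M1 ∧ S ≤ r * M1 := by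
    refine ⟨max (w 0 + 1) (S / r), lt_of_lt_of_le (by linarith) (le_max_left _ _), ?_⟩
    calc S = r * (S / r) := by field_simp
      _ ≤ _ := by gcongr; exact le_max_right _ _
  have hwM : ∀ t ≥ (0:ℝ), -M1 < - w t := by
    refine aux_barrier (fun t => - w t) _ (-M1) hwc.neg (fun t ht => (hweq t ht).neg)
      (by linarith) ?_
    intro t ht h
    have hwt : w t = M1 := by linarith
    have h1 := hvw t ht.le
    have h2 : α (v t) < 0 := hS _ (by rw [hwt] at h1; linarith)
    have := mul_neg_of_neg_of_pos h2 (hwpos t ht.le)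
    linarith
  have hM1pos : 0 < M1 := by linarith
  have hgp : 0 < gp := by
    have := hgbound 0 hIX 0 (Set.mem_Ici.2 le_rfl)
    linarith [this.1, this.2]
  have hM2 : ∃ M2, v 0 < M2 ∧ gp * (E * M1) < mu * M2 := by
    refine ⟨v 0 + gp * (E * M1) / mu, ?_, ?_⟩
    · have : 0 < gp * (E * M1) / mu := by positivity
      linarith
    · have : mu * (v 0 + gp * (E * M1) / mu) = mu * v 0 + gp * (E * M1) := by field_simp
      rw [this]
      linarith [mul_pos hmu hv0]
  obtain ⟨M2, hM2v, hM2⟩ := hM2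
  have huM : ∀ t ≥ (0:ℝ), ∀ x ∈ Set.Icc 0 xstar, u x t ≤ E * M1 := by
    intro t ht x hx
    refine (huE t ht x hx).trans ?_
    gcongr
    linarith [hwM t ht]
  have hvM : ∀ t ≥ (0:ℝ), -M2 < - v t := by
    refine aux_barrier (fun t => - v t) _ (-M2) hvc.neg (fun t ht => (hveq t ht).neg)
      (by linarith) ?_
    intro t ht h
    have hvt : v t = M2 := by linarith
    have hg := (hgbound xstar hXX (v t) (hvpos t ht.le).le).2
    have h1 : g xstar (v t) * u xstar t ≤ gp * (E * M1) :=
      mul_le_mul hg (huM t ht.le xstar hXX) (hupos xstar hXX t ht.le).le hgp.le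
    have h2 : mu * v t = mu * M2 := by rw [hvt]
    linarith
  have hM2pos : 0 < M2 := by linarith
  have hEM : 0 < E * M1 := by positivity
  refine ⟨M1 + M2 + E * M1, by positivity, fun t ht => ⟨?_, ?_, fun x hx => ?_⟩⟩
  · linarith [hwM t ht]
  · linarith [hvM t ht]
  · linarith [huM t ht x hx]
end

section
/- Let (w, u, v) be a classical solution of system (S) with positive data, and suppose there is a constant M₁ > 0 with w(t) ≤ M₁ u(x,t) for all (x,t). Then w(t) ≤ M₂ v(t) for all t ≥ 0, where M₂ := max( w(0)/v(0), M₁ (α(0) + μ)/g_− ). -/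
theorem w_le_M2_v
    (xstar mu : ℝ) (hxstar : 0 < xstar) (hmu : 0 < mu)
    (α : ℝ → ℝ) (g : ℝ → ℝ → ℝ) (p : ℝ → ℝ)
    (αinf α0 : ℝ) (hαinf : αinf < 0)
    (hαcont : ContinuousOn α (Set.Ici 0))
    (hαanti : StrictAntiOn α (Set.Ici 0))
    (hαrange : ∀ s ∈ Set.Ici (0:ℝ), α s ∈ Set.Icc αinf α0)
    (hαlim : Filter.Tendsto α Filter.atTop (nhds αinf))
    (hpC1 : ContDiffOn ℝ 1 p (Set.Icc 0 xstar))
    (hgC2 : ∀ s ∈ Set.Ici (0:ℝ), ContDiffOn ℝ 2 (fun x => g x s) (Set.Icc 0 xstar))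
    (Kg : ℝ)
    (hgderivbdd : ∀ x ∈ Set.Icc 0 xstar, ∀ s ∈ Set.Ici (0:ℝ),
      |deriv (fun y => g y s) x| ≤ Kg ∧ |deriv (deriv (fun y => g y s)) x| ≤ Kg)
    (gm gp : ℝ) (hgm : 0 < gm)
    (hgbound : ∀ x ∈ Set.Icc 0 xstar, ∀ s ∈ Set.Ici (0:ℝ), g x s ∈ Set.Icc gm gp)
    (w v : ℝ → ℝ) (u : ℝ → ℝ → ℝ)
    (hwC1 : ContDiffOn ℝ 1 w (Set.Ici 0))
    (hvC1 : ContDiffOn ℝ 1 v (Set.Ici 0))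
    (huC1 : ContDiffOn ℝ 1 (fun q : ℝ × ℝ => u q.1 q.2) (Set.Icc 0 xstar ×ˢ Set.Ici 0))
    (hu0C1 : ContDiffOn ℝ 1 (fun x => u x 0) (Set.Icc 0 xstar))
    (hweq : ∀ t > (0:ℝ), HasDerivAt w (α (v t) * w t) t)
    (hueq : ∀ t > (0:ℝ), ∀ x ∈ Set.Ioo 0 xstar,
      deriv (fun s => u x s) t + deriv (fun y => g y (v t) * u y t) x = p x * u x t)
    (hbc : ∀ t ≥ (0:ℝ), u 0 t = w t)
    (hveq : ∀ t > (0:ℝ), HasDerivAt v (g xstar (v t) * u xstar t - mu * v t) t)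
    (hw0 : 0 < w 0) (hv0 : 0 < v 0)
    (hu0pos : ∀ x ∈ Set.Icc 0 xstar, 0 < u x 0)
    (hupos : ∀ x ∈ Set.Icc 0 xstar, ∀ t ≥ (0:ℝ), 0 < u x t)
    (M1 : ℝ) (hM1 : 0 < M1)
    (hwu : ∀ x ∈ Set.Icc 0 xstar, ∀ t ≥ (0:ℝ), w t ≤ M1 * u x t)
    :
    ∀ t ≥ (0:ℝ), w t ≤ max (w 0 / v 0) (M1 * (α 0 + mu) / gm) * v t := by
  have hmono : ∀ (f f' : ℝ → ℝ) (T : ℝ), 0 ≤ T → ContinuousOn f (Set.Icc 0 T) →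
      (∀ t ∈ Set.Ioo 0 T, HasDerivAt f (f' t) t) →
      (∀ t ∈ Set.Ioo 0 T, 0 ≤ f' t + mu * f t) → f 0 ≤ f T * Real.exp (mu * T) := by
    intro f f' T hT hc hd hn
    have hE : ∀ t, HasDerivAt (fun t => Real.exp (mu * t)) (Real.exp (mu * t) * mu) t := by
      intro t
      have := ((hasDerivAt_id t).const_mul mu).exp
      simpa using this
    have hm : MonotoneOn (fun t => f t * Real.exp (mu * t)) (Set.Icc 0 T) := by
      apply monotoneOn_of_hasDerivWithinAt_nonneg (convex_Icc 0 T)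
        (f' := fun t => f' t * Real.exp (mu * t) + f t * (Real.exp (mu * t) * mu))
      · exact hc.mul (by fun_prop)
      · intro t ht
        rw [interior_Icc] at ht
        exact ((hd t ht).mul (hE t)).hasDerivWithinAt
      · intro t ht
        rw [interior_Icc] at ht
        have := mul_nonneg (hn t ht) (Real.exp_pos (mu * t)).le
        nlinarith
    have := hm (Set.left_mem_Icc.2 hT) (Set.right_mem_Icc.2 hT) hT
    simpa using this
  have hxm : xstar ∈ Set.Icc 0 xstar := ⟨hxstar.le, le_rfl⟩
  have hvc := hvC1.continuousOn
  have hwc := hwC1.continuousOn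
  have hvpos : ∀ t ≥ (0:ℝ), 0 < v t := by
    by_contra! hcon
    obtain ⟨t, ht, hvt⟩ := hcon
    let S : Set ℝ := Set.Icc 0 t ∩ v ⁻¹' Set.Iic 0
    have hScl : IsClosed S :=
      (hvc.mono Set.Icc_subset_Ici_self).preimage_isClosed_of_isClosed isClosed_Icc isClosed_Iic
    have hSne : S.Nonempty := ⟨t, ⟨ht, le_rfl⟩, hvt⟩
    have hSb : BddBelow S := ⟨0, fun y hy => hy.1.1⟩
    have hs := hScl.csInf_mem hSne hSb
    have hlt : ∀ r ∈ Set.Ioo 0 (sInf S), 0 < v r := by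
      intro r hr
      by_contra! hc
      have : r ∈ S := ⟨⟨hr.1.le, hr.2.le.trans hs.1.2⟩, hc⟩
      exact absurd (csInf_le hSb this) (not_le.2 hr.2)
    have h := hmono v _ (sInf S) hs.1.1 (hvc.mono Set.Icc_subset_Ici_self)
      (fun r hr => hveq r hr.1) (by
        intro r hr
        have h1 := (hgbound xstar hxm (v r) (hlt r hr).le).1
        have h2 := hupos xstar hxm r hr.1.le
        have := mul_nonneg (hgm.le.trans h1) h2.le
        linarith)
    have h3 : v (sInf S) ≤ 0 := hs.2
    have := mul_nonpos_of_nonpos_of_nonneg h3 (Real.exp_pos (mu * sInf S)).le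
    linarith
  intro T hT
  set M := max (w 0 / v 0) (M1 * (α 0 + mu) / gm) with hM
  have hMa : w 0 / v 0 ≤ M := le_max_left _ _
  have hMb : M1 * (α 0 + mu) / gm ≤ M := le_max_right _ _
  have hMpos : 0 < M := (div_pos hw0 hv0).trans_le hMa
  rw [div_le_iff₀ hv0] at hMa
  rw [div_le_iff₀ hgm] at hMb
  have h := hmono (fun t => M * v t - w t) _ T hT
    (((hvc.const_smul M).sub hwc).mono Set.Icc_subset_Ici_self)
    (fun r hr => ((hveq r hr.1).const_mul M).sub (hweq r hr.1)) (by
      intro r hr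
      have h0 := hvpos r hr.1.le
      have h1 := (hgbound xstar hxm (v r) h0.le).1
      have h2 := hupos xstar hxm r hr.1.le
      have hw : 0 < w r := by
        rw [← hbc r hr.1.le]
        exact hupos 0 ⟨le_rfl, hxstar.le⟩ r hr.1.le
      have h3 := hwu xstar hxm r hr.1.le
      have h4 : α (v r) ≤ α 0 := hαanti.antitoneOn (Set.mem_Ici.2 le_rfl) h0.le h0.le
      have h5 : M * (gm * u xstar r) ≤ M * (g xstar (v r) * u xstar r) := by gcongr
      have h6 : (α 0 + mu) * w r ≤ M * (gm * u xstar r) := by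
        have a : M1 * ((α 0 + mu) * w r) ≤ M1 * (M * (gm * u xstar r)) := by
          calc M1 * ((α 0 + mu) * w r) = (M1 * (α 0 + mu)) * w r := by ring
            _ ≤ (M * gm) * w r := by gcongr
            _ ≤ (M * gm) * (M1 * u xstar r) := by gcongr
            _ = _ := by ring
        exact le_of_mul_le_mul_left a hM1
      have h7 : α (v r) * w r ≤ α 0 * w r := by gcongr
      linarith)
  have h8 : 0 ≤ (M * v T - w T) * Real.exp (mu * T) := by
    refine le_trans ?_ h
    simpa using hMa
  have := nonneg_of_mul_nonneg_left h8 (Real.exp_pos _)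
  linarith
end

section
/- Let (w, u, v) be a classical solution of system (S) with positive data. Suppose there is M₃ > 0 with u(x,t) ≤ M₃ w(t) for all (x,t), and that w is uniformly bounded on [0,∞). Then there exist constants M₄ > 0 and γ ∈ (0,1) with μ + γ α_∞ > 0 such that v(t) ≤ M₄ · w(t)^γ for all t ≥ 0. -/
theorem v_le_M4_w_rpow
    (xstar mu : ℝ) (hxstar : 0 < xstar) (hmu : 0 < mu)
    (α : ℝ → ℝ) (g : ℝ → ℝ → ℝ) (p : ℝ → ℝ)
    (αinf α0 : ℝ) (hαinf : αinf < 0)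
    (hαcont : ContinuousOn α (Set.Ici 0))
    (hαanti : StrictAntiOn α (Set.Ici 0))
    (hαrange : ∀ s ∈ Set.Ici (0:ℝ), α s ∈ Set.Icc αinf α0)
    (hαlim : Filter.Tendsto α Filter.atTop (nhds αinf))
    (hpC1 : ContDiffOn ℝ 1 p (Set.Icc 0 xstar))
    (hgC2 : ∀ s ∈ Set.Ici (0:ℝ), ContDiffOn ℝ 2 (fun x => g x s) (Set.Icc 0 xstar))
    (Kg : ℝ)
    (hgderivbdd : ∀ x ∈ Set.Icc 0 xstar, ∀ s ∈ Set.Ici (0:ℝ),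
      |deriv (fun y => g y s) x| ≤ Kg ∧ |deriv (deriv (fun y => g y s)) x| ≤ Kg)
    (gm gp : ℝ) (hgm : 0 < gm)
    (hgbound : ∀ x ∈ Set.Icc 0 xstar, ∀ s ∈ Set.Ici (0:ℝ), g x s ∈ Set.Icc gm gp)
    (w v : ℝ → ℝ) (u : ℝ → ℝ → ℝ)
    (hwC1 : ContDiffOn ℝ 1 w (Set.Ici 0))
    (hvC1 : ContDiffOn ℝ 1 v (Set.Ici 0))
    (huC1 : ContDiffOn ℝ 1 (fun q : ℝ × ℝ => u q.1 q.2) (Set.Icc 0 xstar ×ˢ Set.Ici 0))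
    (hu0C1 : ContDiffOn ℝ 1 (fun x => u x 0) (Set.Icc 0 xstar))
    (hweq : ∀ t > (0:ℝ), HasDerivAt w (α (v t) * w t) t)
    (hueq : ∀ t > (0:ℝ), ∀ x ∈ Set.Ioo 0 xstar,
      deriv (fun s => u x s) t + deriv (fun y => g y (v t) * u y t) x = p x * u x t)
    (hbc : ∀ t ≥ (0:ℝ), u 0 t = w t)
    (hveq : ∀ t > (0:ℝ), HasDerivAt v (g xstar (v t) * u xstar t - mu * v t) t)
    (hw0 : 0 < w 0) (hv0 : 0 < v 0)
    (hu0pos : ∀ x ∈ Set.Icc 0 xstar, 0 < u x 0)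
    (hupos : ∀ x ∈ Set.Icc 0 xstar, ∀ t ≥ (0:ℝ), 0 < u x t)
    (M3 : ℝ) (hM3 : 0 < M3)
    (huw : ∀ x ∈ Set.Icc 0 xstar, ∀ t ≥ (0:ℝ), u x t ≤ M3 * w t)
    (B : ℝ) (hwbdd : ∀ t ≥ (0:ℝ), w t ≤ B)
    :
    ∃ M4 > (0:ℝ), ∃ γ : ℝ, 0 < γ ∧ γ < 1 ∧ 0 < mu + γ * αinf ∧
      ∀ t ≥ (0:ℝ), v t ≤ M4 * w t ^ γ := by
  have hw : ∀ t ≥ (0:ℝ), 0 < w t := fun t ht => by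
    have := hupos 0 ⟨le_refl _, hxstar.le⟩ t ht
    rwa [hbc t ht] at this
  have hxm : xstar ∈ Set.Icc 0 xstar := ⟨hxstar.le, le_refl _⟩
  have hvc : ContinuousOn v (Set.Ici 0) := hvC1.continuousOn
  have hwc : ContinuousOn w (Set.Ici 0) := hwC1.continuousOn
  have hE : ∀ c t : ℝ, HasDerivAt (fun s => Real.exp (c * s)) (Real.exp (c * t) * c) t := by
    intro c t
    have h1 : HasDerivAt (fun s => c * s) c t := by
      simpa using (hasDerivAt_id t).const_mul c
    exact h1.exp
  have hv : ∀ t ≥ (0:ℝ), 0 < v t := by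
    intro t ht
    by_contra hcon
    push Not at hcon
    have hcomp : IsCompact (Set.Icc 0 t ∩ v ⁻¹' Set.Iic 0) := by
      apply IsCompact.of_isClosed_subset isCompact_Icc _ Set.inter_subset_left
      exact (hvc.mono Set.Icc_subset_Ici_self).preimage_isClosed_of_isClosed isClosed_Icc
        isClosed_Iic
    obtain ⟨a, ⟨⟨ha0, hat⟩, hva⟩, hleast⟩ :=
      hcomp.exists_isLeast ⟨t, ⟨ht, le_refl _⟩, hcon⟩
    have hva' : v a ≤ 0 := hva
    have hmono : MonotoneOn (fun s => v s * Real.exp (mu * s)) (Set.Icc 0 a) := by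
      apply monotoneOn_of_hasDerivWithinAt_nonneg (convex_Icc 0 a)
        (f' := fun s => (g xstar (v s) * u xstar s - mu * v s) * Real.exp (mu * s)
          + v s * (Real.exp (mu * s) * mu))
      · apply (hvc.mono Set.Icc_subset_Ici_self).mul
        fun_prop
      · intro s hs
        rw [interior_Icc] at hs
        exact ((hveq s hs.1).mul (hE mu s)).hasDerivWithinAt
      · intro s hs
        rw [interior_Icc] at hs
        have hvs : 0 ≤ v s := by
          by_contra hn
          push Not at hn
          have : a ≤ s := hleast ⟨⟨hs.1.le, hs.2.le.trans hat⟩, hn.le⟩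
          linarith [hs.2]
        have h1 := (hgbound xstar hxm (v s) hvs).1
        have h2 := hupos xstar hxm s hs.1.le
        have h3 : 0 ≤ g xstar (v s) * u xstar s := mul_nonneg (hgm.le.trans h1) h2.le
        have h4 := mul_nonneg h3 (Real.exp_pos (mu * s)).le
        linarith
    have := hmono ⟨le_refl _, ha0⟩ ⟨ha0, le_refl _⟩ ha0
    simp only [mul_zero, Real.exp_zero, mul_one] at this
    have h5 := mul_nonpos_of_nonpos_of_nonneg hva' (Real.exp_pos (mu * a)).le
    linarith
  obtain ⟨γ, hγ0, hγ1, hδ⟩ : ∃ γ : ℝ, 0 < γ ∧ γ < 1 ∧ 0 < mu + γ * αinf := by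
    refine ⟨mu / (mu - αinf), div_pos hmu (by linarith), ?_, ?_⟩
    · rw [div_lt_one (by linarith)]; linarith
    · have h1 : mu / (mu - αinf) * (mu - αinf) = mu := div_mul_cancel₀ _ (by linarith)
      have h2 : 0 < mu / (mu - αinf) := div_pos hmu (by linarith)
      nlinarith
  have hgp : 0 < gp := by
    have := hgbound xstar hxm (v 0) hv0.le
    linarith [this.1, this.2]
  have hB : 0 < B := hw0.trans_le (hwbdd 0 le_rfl)
  obtain ⟨δ, hδe⟩ : ∃ δ, δ = mu + γ * αinf := ⟨_, rfl⟩
  rw [← hδe] at hδ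
  obtain ⟨K, hK⟩ : ∃ K, K = gp * M3 * B ^ (1 - γ) / δ := ⟨_, rfl⟩
  have hK0 : 0 < K := by rw [hK]; positivity
  have hKδ : K * δ = gp * M3 * B ^ (1 - γ) := by rw [hK]; field_simp
  have hh0 : 0 < v 0 * w 0 ^ (-γ) := mul_pos hv0 (Real.rpow_pos_of_pos hw0 _)
  have hanti : AntitoneOn (fun s => (v s * w s ^ (-γ) - K) * Real.exp (δ * s)) (Set.Ici 0) := by
    apply antitoneOn_of_hasDerivWithinAt_nonpos (convex_Ici 0)
      (f' := fun s => ((g xstar (v s) * u xstar s - mu * v s) * w s ^ (-γ)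
          + v s * (α (v s) * w s * (-γ) * w s ^ (-γ - 1))) * Real.exp (δ * s)
        + (v s * w s ^ (-γ) - K) * (Real.exp (δ * s) * δ))
    · apply ContinuousOn.mul
      · apply ContinuousOn.sub _ continuousOn_const
        exact hvc.mul (hwc.rpow_const fun s hs => Or.inl (hw s hs).ne')
      · fun_prop
    · intro s hs
      rw [interior_Ici] at hs
      have hs : 0 < s := hs
      exact ((((hveq s hs).mul ((hweq s hs).rpow_const (p := -γ)
        (Or.inl (hw s hs.le).ne'))).sub_const K).mul (hE δ s)).hasDerivWithinAt
    · intro s hs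
      rw [interior_Ici] at hs
      have hs : 0 < s := hs
      have hws := hw s hs.le
      have hvs := hv s hs.le
      have hp : 0 < w s ^ (-γ) := Real.rpow_pos_of_pos hws _
      have e1 : w s * w s ^ (-γ - 1) = w s ^ (-γ) := by
        rw [Real.rpow_sub_one hws.ne']; field_simp
      have e2 : w s * w s ^ (-γ) = w s ^ (1 - γ) := by
        rw [sub_eq_add_neg, Real.rpow_add hws, Real.rpow_one]
      have b1 : w s ^ (1 - γ) ≤ B ^ (1 - γ) :=
        Real.rpow_le_rpow hws.le (hwbdd s hs.le) (by linarith)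
      have b2 : g xstar (v s) * u xstar s ≤ gp * (M3 * w s) :=
        mul_le_mul (hgbound xstar hxm (v s) hvs.le).2 (huw xstar hxm s hs.le)
          (hupos xstar hxm s hs.le).le hgp.le
      have b3 : g xstar (v s) * u xstar s * w s ^ (-γ) ≤ K * δ := by
        calc _ ≤ gp * (M3 * w s) * w s ^ (-γ) := mul_le_mul_of_nonneg_right b2 hp.le
          _ = gp * M3 * w s ^ (1 - γ) := by rw [← e2]; ring
          _ ≤ gp * M3 * B ^ (1 - γ) := mul_le_mul_of_nonneg_left b1 (by positivity)
          _ = _ := hKδ.symm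
      have b4 : γ * αinf * (v s * w s ^ (-γ)) ≤ γ * α (v s) * (v s * w s ^ (-γ)) :=
        mul_le_mul_of_nonneg_right
          (mul_le_mul_of_nonneg_left (hαrange (v s) hvs.le).1 hγ0.le) (by positivity)
      have e3 : ((g xstar (v s) * u xstar s - mu * v s) * w s ^ (-γ)
          + v s * (α (v s) * w s * (-γ) * w s ^ (-γ - 1))) * Real.exp (δ * s)
        + (v s * w s ^ (-γ) - K) * (Real.exp (δ * s) * δ)
        = (g xstar (v s) * u xstar s * w s ^ (-γ) - K * δ
          + (γ * αinf * (v s * w s ^ (-γ)) - γ * α (v s) * (v s * w s ^ (-γ))))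
          * Real.exp (δ * s) := by
        have : v s * (α (v s) * w s * (-γ) * w s ^ (-γ - 1))
            = - (γ * α (v s) * (v s * w s ^ (-γ))) := by rw [← e1]; ring
        rw [this, hδe]; ring
      rw [e3]
      exact mul_nonpos_of_nonpos_of_nonneg (by linarith) (Real.exp_pos _).le
  refine ⟨K + v 0 * w 0 ^ (-γ), by positivity, γ, hγ0, hγ1, hδe ▸ hδ, fun t ht => ?_⟩
  have h1 := hanti (Set.mem_Ici.2 le_rfl) (Set.mem_Ici.2 ht) ht
  simp only [mul_zero, Real.exp_zero, mul_one] at h1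
  have hexp : 1 ≤ Real.exp (δ * t) := Real.one_le_exp (by positivity)
  have h2 : v t * w t ^ (-γ) ≤ K + v 0 * w 0 ^ (-γ) := by
    by_contra hn
    push Not at hn
    nlinarith
  have hp : 0 < w t ^ γ := Real.rpow_pos_of_pos (hw t ht) _
  rw [Real.rpow_neg (hw t ht).le γ, ← div_eq_mul_inv, div_le_iff₀ hp] at h2
  exact h2
end

section
/- Assume α(0) < 0. Then every classical solution (w, u, v) of system (S) with nonnegative data converges to zero at an exponential rate: there exist constants C > 0 and δ > 0 such that w(t) + ∫₀^{x*} u(x,t) dx + v(t) ≤ C e^{−δ t} for all t ≥ 0. -/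
/-- At a maximum over an interval to the left, the derivative is nonnegative. -/
lemma deriv_nonneg_of_left_max {f : ℝ → ℝ} {d a b : ℝ} (hf : HasDerivAt f d a) (hb : b < a)
    (hmax : ∀ y ∈ Set.Icc b a, f y ≤ f a) : 0 ≤ d := by
  have h1 := (hasDerivWithinAt_iff_tendsto_slope' (s := Set.Iio a) (by simp)).1
    (hf.hasDerivWithinAt (s := Set.Iio a))
  refine ge_of_tendsto h1 ?_
  have h2 : Set.Ioo b a ∈ nhdsWithin a (Set.Iio a) := Ioo_mem_nhdsLT hb
  filter_upwards [h2] with y hy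
  rw [slope_def_field]
  have := hmax y ⟨hy.1.le, hy.2.le⟩
  exact div_nonneg_of_nonpos (by linarith) (by linarith [hy.2])

lemma le_init_of_deriv_nonpos {f f' : ℝ → ℝ} (hc : ContinuousOn f (Set.Ici 0))
    (hd : ∀ t > (0:ℝ), HasDerivAt f (f' t) t) (hn : ∀ t > (0:ℝ), f' t ≤ 0) :
    ∀ t ≥ (0:ℝ), f t ≤ f 0 := by
  have : AntitoneOn f (Set.Ici 0) := by
    refine antitoneOn_of_deriv_nonpos (convex_Ici 0) hc ?_ ?_
    · intro x hx
      rw [interior_Ici] at hx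
      exact (hd x hx).differentiableAt.differentiableWithinAt
    · intro x hx
      rw [interior_Ici] at hx
      rw [(hd x hx).deriv]
      exact hn x hx
  intro t ht
  exact this (by simp) ht ht

theorem extinction
    (xstar mu : ℝ) (hxstar : 0 < xstar) (hmu : 0 < mu)
    (α : ℝ → ℝ) (g : ℝ → ℝ → ℝ) (p : ℝ → ℝ)
    (αinf α0 : ℝ) (hαinf : αinf < 0)
    (hαcont : ContinuousOn α (Set.Ici 0))
    (hαanti : StrictAntiOn α (Set.Ici 0))
    (hαrange : ∀ s ∈ Set.Ici (0:ℝ), α s ∈ Set.Icc αinf α0)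
    (hαlim : Filter.Tendsto α Filter.atTop (nhds αinf))
    (hpC1 : ContDiffOn ℝ 1 p (Set.Icc 0 xstar))
    (hgC2 : ∀ s ∈ Set.Ici (0:ℝ), ContDiffOn ℝ 2 (fun x => g x s) (Set.Icc 0 xstar))
    (Kg : ℝ)
    (hgderivbdd : ∀ x ∈ Set.Icc 0 xstar, ∀ s ∈ Set.Ici (0:ℝ),
      |deriv (fun y => g y s) x| ≤ Kg ∧ |deriv (deriv (fun y => g y s)) x| ≤ Kg)
    (gm gp : ℝ) (hgm : 0 < gm)
    (hgbound : ∀ x ∈ Set.Icc 0 xstar, ∀ s ∈ Set.Ici (0:ℝ), g x s ∈ Set.Icc gm gp)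
    (w v : ℝ → ℝ) (u : ℝ → ℝ → ℝ)
    (hwC1 : ContDiffOn ℝ 1 w (Set.Ici 0))
    (hvC1 : ContDiffOn ℝ 1 v (Set.Ici 0))
    (huC1 : ContDiffOn ℝ 1 (fun q : ℝ × ℝ => u q.1 q.2) (Set.Icc 0 xstar ×ˢ Set.Ici 0))
    (hu0C1 : ContDiffOn ℝ 1 (fun x => u x 0) (Set.Icc 0 xstar))
    (hweq : ∀ t > (0:ℝ), HasDerivAt w (α (v t) * w t) t)
    (hueq : ∀ t > (0:ℝ), ∀ x ∈ Set.Ioo 0 xstar,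
      deriv (fun s => u x s) t + deriv (fun y => g y (v t) * u y t) x = p x * u x t)
    (hbc : ∀ t ≥ (0:ℝ), u 0 t = w t)
    (hveq : ∀ t > (0:ℝ), HasDerivAt v (g xstar (v t) * u xstar t - mu * v t) t)
    (hw0 : 0 ≤ w 0) (hv0 : 0 ≤ v 0)
    (hu0nn : ∀ x ∈ Set.Icc 0 xstar, 0 ≤ u x 0)
    (hwnn : ∀ t ≥ (0:ℝ), 0 ≤ w t) (hvnn : ∀ t ≥ (0:ℝ), 0 ≤ v t)
    (hunn : ∀ x ∈ Set.Icc 0 xstar, ∀ t ≥ (0:ℝ), 0 ≤ u x t)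
    (hα0 : α 0 < 0)
    :
    ∃ C > (0:ℝ), ∃ δ > (0:ℝ), ∀ t ≥ (0:ℝ),
      w t + (∫ x in (0:ℝ)..xstar, u x t) + v t ≤ C * Real.exp (-δ * t) := by
  obtain ⟨δ, hδ, hδα, hδμ⟩ : ∃ δ > (0:ℝ), δ ≤ -α 0 ∧ δ < mu :=
    ⟨min (-α 0) (mu / 2), lt_min (by linarith) (by linarith), min_le_left _ _,
      lt_of_le_of_lt (min_le_right _ _) (by linarith)⟩
  have hexpd : ∀ (c t : ℝ), HasDerivAt (fun s : ℝ => Real.exp (c * s)) (Real.exp (c * t) * c) t := by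
    intro c t
    have := ((hasDerivAt_id t).const_mul c).exp
    simpa using this
  obtain ⟨P, hP⟩ := isCompact_Icc.exists_bound_of_continuousOn hpC1.continuousOn
  obtain ⟨M, hM⟩ := isCompact_Icc.exists_bound_of_continuousOn hu0C1.continuousOn
  have h0mem : (0:ℝ) ∈ Set.Icc 0 xstar := ⟨le_rfl, hxstar.le⟩
  have h1mem : xstar ∈ Set.Icc 0 xstar := ⟨hxstar.le, le_rfl⟩
  have hP0 : 0 ≤ P := (norm_nonneg _).trans (hP 0 h0mem)
  have hM0 : 0 ≤ M := (norm_nonneg _).trans (hM 0 h0mem)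
  have hKg : 0 ≤ Kg := (abs_nonneg _).trans (hgderivbdd 0 h0mem 0 (by simp)).1
  have hgp : 0 < gp := by
    have := hgbound 0 h0mem 0 (by simp)
    linarith [this.1, this.2]
  have hw : ∀ t ≥ (0:ℝ), Real.exp (δ * t) * w t ≤ M := by
    intro t ht
    have h := le_init_of_deriv_nonpos (f := fun s => Real.exp (δ * s) * w s)
      (ContinuousOn.mul (by fun_prop) hwC1.continuousOn)
      (fun s hs => (hexpd δ s).mul (hweq s hs)) ?_ t ht
    · have h2 := hM 0 h0mem
      simp only [hbc 0 le_rfl, Real.norm_eq_abs] at h2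
      have h3 := le_abs_self (w 0)
      simp only [mul_zero, Real.exp_zero, one_mul] at h
      linarith
    · intro s hs
      have h1 : α (v s) ≤ α 0 := hαanti.antitoneOn (by simp) (hvnn s hs.le) (hvnn s hs.le)
      have h2 : (δ + α (v s)) * (Real.exp (δ * s) * w s) ≤ 0 :=
        mul_nonpos_of_nonpos_of_nonneg (by linarith)
          (mul_nonneg (Real.exp_pos _).le (hwnn s hs.le))
      linarith
  set k : ℝ := (P + Kg + δ + 1) / gm with hk
  have hk0 : 0 < k := by positivity
  have hkgm : k * gm = P + Kg + δ + 1 := by rw [hk]; field_simp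
  have hucont : ContinuousOn (fun q : ℝ × ℝ => u q.1 q.2) (Set.Icc 0 xstar ×ˢ Set.Ici 0) :=
    huC1.continuousOn
  have hz : ∀ x1 ∈ Set.Ioo 0 xstar, ∀ T ≥ (0:ℝ),
      Real.exp (δ * T) * (Real.exp (-k * x1) * u x1 T) ≤ M := by
    intro x1 hx1 T hT
    have hsub : Set.Icc 0 x1 ×ˢ Set.Icc 0 T ⊆ Set.Icc 0 xstar ×ˢ Set.Ici (0:ℝ) :=
      Set.prod_mono (Set.Icc_subset_Icc_right hx1.2.le) Set.Icc_subset_Ici_self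
    obtain ⟨⟨x, t⟩, ⟨hx, ht⟩, hmax⟩ := (isCompact_Icc.prod isCompact_Icc).exists_isMaxOn
      (s := Set.Icc 0 x1 ×ˢ Set.Icc 0 T)
      (f := fun q : ℝ × ℝ => Real.exp (δ * q.2) * (Real.exp (-k * q.1) * u q.1 q.2))
      ⟨(0, 0), ⟨le_rfl, hx1.1.le⟩, ⟨le_rfl, hT⟩⟩
      (ContinuousOn.mul (by fun_prop) (ContinuousOn.mul (by fun_prop) (hucont.mono hsub)))
    simp only at hx ht
    have hmax' : ∀ y ∈ Set.Icc 0 x1, ∀ s ∈ Set.Icc 0 T,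
        Real.exp (δ * s) * (Real.exp (-k * y) * u y s) ≤
        Real.exp (δ * t) * (Real.exp (-k * x) * u x t) := fun y hy s hs =>
      hmax (show (y, s) ∈ Set.Icc 0 x1 ×ˢ Set.Icc 0 T from ⟨hy, hs⟩)
    refine (hmax' x1 ⟨hx1.1.le, le_rfl⟩ T ⟨hT, le_rfl⟩).trans ?_
    have hxs : x ∈ Set.Icc 0 xstar := ⟨hx.1, hx.2.trans hx1.2.le⟩
    have hunn' := hunn x hxs t ht.1
    rcases hx.1.eq_or_lt with h0 | hxpos
    · rw [← h0, hbc t ht.1]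
      simpa using hw t ht.1
    rcases ht.1.eq_or_lt with h0 | htpos
    · rw [← h0]
      have h1 : Real.exp (-k * x) ≤ 1 := Real.exp_le_one_iff.2 (by nlinarith)
      have h2 := hM x hxs
      have h3 := hunn x hxs 0 le_rfl
      rw [Real.norm_eq_abs, abs_of_nonneg h3] at h2
      simp only [mul_zero, Real.exp_zero, one_mul]
      nlinarith
    rcases hunn'.eq_or_lt with h0 | hupos
    · rw [← h0]; simpa using hM0
    exfalso
    have hxo : x ∈ Set.Ioo 0 xstar := ⟨hxpos, lt_of_le_of_lt hx.2 hx1.2⟩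
    have hud : DifferentiableAt ℝ (fun q : ℝ × ℝ => u q.1 q.2) (x, t) :=
      (huC1.contDiffAt (prod_mem_nhds (Icc_mem_nhds hxo.1 hxo.2) (Ici_mem_nhds htpos))).differentiableAt
        (by norm_num)
    have hut : DifferentiableAt ℝ (fun s => u x s) t :=
      DifferentiableAt.comp (g := fun q : ℝ × ℝ => u q.1 q.2) (f := fun s : ℝ => (x, s)) t hud
        (by fun_prop)
    have hux : DifferentiableAt ℝ (fun y => u y t) x :=
      DifferentiableAt.comp (g := fun q : ℝ × ℝ => u q.1 q.2) (f := fun y : ℝ => (y, t)) x hud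
        (by fun_prop)
    have hvt := hvnn t ht.1
    have hgx : DifferentiableAt ℝ (fun y => g y (v t)) x :=
      ((hgC2 (v t) hvt).contDiffAt (Icc_mem_nhds hxo.1 hxo.2)).differentiableAt (by norm_num)
    have hpde := hueq t htpos x hxo
    have hprod : HasDerivAt (fun y => g y (v t) * u y t)
        (deriv (fun y => g y (v t)) x * u x t + g x (v t) * deriv (fun y => u y t) x) x :=
      hgx.hasDerivAt.mul hux.hasDerivAt
    rw [hprod.deriv] at hpde
    clear hprod
    have ht' := deriv_nonneg_of_left_max
      (f := fun s => Real.exp (δ * s) * (Real.exp (-k * x) * u x s))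
      ((hexpd δ t).mul (hut.hasDerivAt.const_mul (Real.exp (-k * x)))) htpos
      (fun s hs => hmax' x hx s ⟨hs.1, hs.2.trans ht.2⟩)
    have hx' := deriv_nonneg_of_left_max
      (f := fun y => Real.exp (δ * t) * (Real.exp (-k * y) * u y t))
      (((hexpd (-k) x).mul hux.hasDerivAt).const_mul (Real.exp (δ * t))) hxpos
      (fun y hy => hmax' y ⟨hy.1, hy.2.trans hx.2⟩ t ht)
    have hE1 := Real.exp_pos (δ * t)
    have hE2 := Real.exp_pos (-k * x)
    generalize deriv (fun s => u x s) t = ut at *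
    generalize deriv (fun y => u y t) x = ux at *
    have ht2 : 0 ≤ δ * u x t + ut := by
      refine nonneg_of_mul_nonneg_right (a := Real.exp (δ * t) * Real.exp (-k * x)) ?_ (by positivity)
      linarith
    have hx2 : 0 ≤ -k * u x t + ux := by
      refine nonneg_of_mul_nonneg_right (a := Real.exp (δ * t) * Real.exp (-k * x)) ?_ (by positivity)
      linarith
    have hg1 := (hgbound x hxs (v t) hvt).1
    have hg2 := (abs_le.1 (hgderivbdd x hxs (v t) hvt).1).1
    have hp2 := (abs_le.1 (hP x hxs)).2
    generalize deriv (fun y => g y (v t)) x = gx at *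
    have e1 : 0 ≤ g x (v t) * (-k * u x t + ux) := mul_nonneg (by linarith) hx2
    have e2 : k * gm ≤ k * g x (v t) := mul_le_mul_of_nonneg_left hg1 hk0.le
    have e3 : (p x - gx + δ - k * g x (v t)) * u x t < 0 :=
      mul_neg_of_neg_of_pos (by linarith) hupos
    nlinarith
  set B : ℝ := M * Real.exp (k * xstar) with hB
  have hB0 : 0 ≤ B := by positivity
  have hu1 : ∀ x ∈ Set.Ioo 0 xstar, ∀ t ≥ (0:ℝ), u x t ≤ B * Real.exp (-δ * t) := by
    intro x hx t ht
    have h := hz x hx t ht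
    have e : u x t = (Real.exp (δ * t) * (Real.exp (-k * x) * u x t)) *
        (Real.exp (k * x) * Real.exp (-δ * t)) := by
      have a1 : Real.exp (δ * t) * Real.exp (-δ * t) = 1 := by rw [← Real.exp_add]; simp
      have a2 : Real.exp (-k * x) * Real.exp (k * x) = 1 := by rw [← Real.exp_add]; simp
      calc u x t = (Real.exp (δ * t) * Real.exp (-δ * t)) *
            (Real.exp (-k * x) * Real.exp (k * x)) * u x t := by rw [a1, a2]; ring
        _ = _ := by ring
    rw [e]
    calc _ ≤ M * (Real.exp (k * x) * Real.exp (-δ * t)) :=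
          mul_le_mul_of_nonneg_right h (by positivity)
      _ ≤ M * (Real.exp (k * xstar) * Real.exp (-δ * t)) := by
          gcongr
          exact hx.2.le
      _ = _ := by rw [hB]; ring
  have hu2 : ∀ t ≥ (0:ℝ), u xstar t ≤ B * Real.exp (-δ * t) := by
    intro t ht
    have hc : ContinuousOn (fun x => u x t) (Set.Icc 0 xstar) :=
      hucont.comp (f := fun x : ℝ => (x, t)) (by fun_prop) (fun x hx => ⟨hx, ht⟩)
    have hc2 : Filter.Tendsto (fun x => u x t) (nhdsWithin xstar (Set.Ioo 0 xstar))
        (nhds (u xstar t)) := (hc xstar h1mem).mono_left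
          (nhdsWithin_mono _ Set.Ioo_subset_Icc_self)
    haveI : (nhdsWithin xstar (Set.Ioo 0 xstar)).NeBot := by
      rw [nhdsWithin_Ioo_eq_nhdsLT hxstar]; infer_instance
    refine le_of_tendsto hc2 ?_
    filter_upwards [self_mem_nhdsWithin] with x hx
    exact hu1 x hx t ht
  have hI : ∀ t ≥ (0:ℝ), (∫ x in (0:ℝ)..xstar, u x t) ≤ B * xstar * Real.exp (-δ * t) := by
    intro t ht
    have h := intervalIntegral.norm_integral_le_of_norm_le_const (a := 0) (b := xstar)
      (f := fun x => u x t) (C := B * Real.exp (-δ * t)) ?_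
    · have h2 := (le_abs_self _).trans h
      rw [sub_zero, abs_of_pos hxstar] at h2
      linarith
    · intro x hx
      rw [Set.uIoc_of_le hxstar.le] at hx
      rw [Real.norm_eq_abs, abs_of_nonneg (hunn x ⟨hx.1.le, hx.2⟩ t ht)]
      rcases hx.2.eq_or_lt with h0 | h0
      · rw [h0]; exact hu2 t ht
      · exact hu1 x ⟨hx.1, h0⟩ t ht
  set D : ℝ := gp * B / (mu - δ) with hD
  have hμδ : 0 < mu - δ := by linarith
  have hD0 : 0 ≤ D := by positivity
  have hDm : D * (mu - δ) = gp * B := by rw [hD]; field_simp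
  have hv : ∀ t ≥ (0:ℝ), v t ≤ (v 0 + D) * Real.exp (-δ * t) := by
    intro t ht
    have h := le_init_of_deriv_nonpos
      (f := fun s => Real.exp (mu * s) * v s - D * Real.exp ((mu - δ) * s))
      (ContinuousOn.sub (ContinuousOn.mul (by fun_prop) hvC1.continuousOn) (by fun_prop))
      (fun s hs => ((hexpd mu s).mul (hveq s hs)).sub ((hexpd (mu - δ) s).const_mul D)) ?_ t ht
    · simp only [mul_zero, Real.exp_zero, one_mul, mul_one] at h
      have a0 : Real.exp (mu * t) = Real.exp ((mu - δ) * t) * Real.exp (δ * t) := by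
        rw [← Real.exp_add]; ring_nf
      have a1 : Real.exp (δ * t) * Real.exp (-δ * t) = 1 := by rw [← Real.exp_add]; simp
      have a2 : 1 ≤ Real.exp ((mu - δ) * t) := Real.one_le_exp (by positivity)
      have a3 : Real.exp ((mu - δ) * t) * (Real.exp (δ * t) * v t) ≤
          Real.exp ((mu - δ) * t) * (v 0 + D) := by
        rw [← mul_assoc, ← a0]
        nlinarith
      have a4 := le_of_mul_le_mul_left a3 (by positivity)
      calc v t = (Real.exp (δ * t) * Real.exp (-δ * t)) * v t := by rw [a1, one_mul]
        _ = (Real.exp (δ * t) * v t) * Real.exp (-δ * t) := by ring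
        _ ≤ _ := mul_le_mul_of_nonneg_right a4 (Real.exp_pos _).le
    · intro s hs
      have hg1 := hgbound xstar h1mem (v s) (hvnn s hs.le)
      have b1 : g xstar (v s) * u xstar s ≤ gp * (B * Real.exp (-δ * s)) :=
        mul_le_mul hg1.2 (hu2 s hs.le) (hunn xstar h1mem s hs.le) hgp.le
      have b2 : Real.exp ((mu - δ) * s) = Real.exp (mu * s) * Real.exp (-δ * s) := by
        rw [← Real.exp_add]; ring_nf
      have b3 := mul_le_mul_of_nonneg_left b1 (Real.exp_pos (mu * s)).le
      have b4 : D * (Real.exp ((mu - δ) * s) * (mu - δ)) =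
          Real.exp (mu * s) * (gp * (B * Real.exp (-δ * s))) := by
        rw [b2]
        linear_combination (Real.exp (mu * s) * Real.exp (-δ * s)) * hDm
      rw [b4]
      linarith
  have hw2 : ∀ t ≥ (0:ℝ), w t ≤ M * Real.exp (-δ * t) := by
    intro t ht
    have a1 : Real.exp (δ * t) * Real.exp (-δ * t) = 1 := by rw [← Real.exp_add]; simp
    calc w t = (Real.exp (δ * t) * Real.exp (-δ * t)) * w t := by rw [a1, one_mul]
        _ = (Real.exp (δ * t) * w t) * Real.exp (-δ * t) := by ring
        _ ≤ _ := mul_le_mul_of_nonneg_right (hw t ht) (Real.exp_pos _).le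
  refine ⟨M + B * xstar + (v 0 + D) + 1, by positivity, δ, hδ, fun t ht => ?_⟩
  have := hw2 t ht
  have := hI t ht
  have := hv t ht
  have := Real.exp_pos (-δ * t)
  linarith
end

section
/- Under assumptions (A), system (S) admits a positive steady state if and only if α(0) > 0. Moreover, when it exists, the positive steady state is unique. -/
/-- A positive steady state of system (S). -/
def IsSteadyState (xstar mu : ℝ) (α : ℝ → ℝ) (g : ℝ → ℝ → ℝ) (p : ℝ → ℝ)
    (wb : ℝ) (ub : ℝ → ℝ) (vb : ℝ) : Prop :=
  0 < wb ∧ 0 < vb ∧ (∀ x ∈ Set.Icc 0 xstar, 0 < ub x) ∧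
  ContDiffOn ℝ 1 ub (Set.Icc 0 xstar) ∧
  α vb * wb = 0 ∧
  (∀ x ∈ Set.Icc 0 xstar,
    HasDerivWithinAt (fun y => g y vb * ub y) (p x * ub x) (Set.Icc 0 xstar) x) ∧
  ub 0 = wb ∧ g xstar vb * ub xstar = mu * vb

theorem steady_state_existence_uniqueness
    (xstar mu : ℝ) (hxstar : 0 < xstar) (hmu : 0 < mu)
    (α : ℝ → ℝ) (g : ℝ → ℝ → ℝ) (p : ℝ → ℝ)
    (αinf α0 : ℝ) (hαinf : αinf < 0)
    (hαcont : ContinuousOn α (Set.Ici 0))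
    (hαanti : StrictAntiOn α (Set.Ici 0))
    (hαrange : ∀ s ∈ Set.Ici (0:ℝ), α s ∈ Set.Icc αinf α0)
    (hαlim : Filter.Tendsto α Filter.atTop (nhds αinf))
    (hpC1 : ContDiffOn ℝ 1 p (Set.Icc 0 xstar))
    (hgC2 : ∀ s ∈ Set.Ici (0:ℝ), ContDiffOn ℝ 2 (fun x => g x s) (Set.Icc 0 xstar))
    (Kg : ℝ)
    (hgderivbdd : ∀ x ∈ Set.Icc 0 xstar, ∀ s ∈ Set.Ici (0:ℝ),
      |deriv (fun y => g y s) x| ≤ Kg ∧ |deriv (deriv (fun y => g y s)) x| ≤ Kg)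
    (gm gp : ℝ) (hgm : 0 < gm)
    (hgbound : ∀ x ∈ Set.Icc 0 xstar, ∀ s ∈ Set.Ici (0:ℝ), g x s ∈ Set.Icc gm gp)
    :
    ((∃ wb vb : ℝ, ∃ ub : ℝ → ℝ, IsSteadyState xstar mu α g p wb ub vb) ↔ 0 < α 0)
    ∧ ∀ wb vb wb' vb' : ℝ, ∀ ub ub' : ℝ → ℝ,
        IsSteadyState xstar mu α g p wb ub vb →
        IsSteadyState xstar mu α g p wb' ub' vb' →
        wb = wb' ∧ vb = vb' ∧ ∀ x ∈ Set.Icc 0 xstar, ub x = ub' x := by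
  have key : ∀ wb vb : ℝ, ∀ ub : ℝ → ℝ, IsSteadyState xstar mu α g p wb ub vb → α vb = 0 := by
    intro wb vb ub h
    obtain ⟨h1, _, _, _, h5, _⟩ := h
    exact (mul_eq_zero.mp h5).resolve_right h1.ne'
  have h0m : (0:ℝ) ∈ Set.Icc 0 xstar := ⟨le_rfl, hxstar.le⟩
  have hxm : xstar ∈ Set.Icc 0 xstar := ⟨hxstar.le, le_rfl⟩
  refine ⟨⟨?_, ?_⟩, ?_⟩
  · rintro ⟨wb, vb, ub, h⟩
    have h0 := key _ _ _ h
    have hv := h.2.1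
    have := hαanti (Set.mem_Ici.mpr le_rfl) (Set.mem_Ici.mpr hv.le) hv
    linarith
  · intro hα
    obtain ⟨M, hM, hM0⟩ : ∃ M, α M < 0 ∧ 0 ≤ M :=
      ((hαlim.eventually (gt_mem_nhds hαinf)).and (Filter.eventually_ge_atTop 0)).exists
    obtain ⟨v, hv, hv0⟩ : (0:ℝ) ∈ α '' Set.Icc 0 M :=
      intermediate_value_Icc' hM0 (hαcont.mono (fun x hx => hx.1)) ⟨hM.le, hα.le⟩
    have hvpos : 0 < v := by
      rcases hv.1.lt_or_eq with h | h
      · exact h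
      · rw [← h] at hv0; linarith
    have hgpos : ∀ x ∈ Set.Icc 0 xstar, 0 < g x v := fun x hx =>
      lt_of_lt_of_le hgm (hgbound x hx v hv.1).1
    have hgc := hgC2 v hv.1
    have hqc : ContinuousOn (fun x => p x / g x v) (Set.Icc 0 xstar) :=
      hpC1.continuousOn.div hgc.continuousOn (fun x hx => (hgpos x hx).ne')
    set q : ℝ → ℝ := Set.IccExtend hxstar.le ((Set.Icc 0 xstar).domRestrict (fun x => p x / g x v)) with hq
    have hqcont : Continuous q := (continuousOn_iff_continuous_domRestrict.mp hqc).Icc_extend'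
    have hqe : ∀ x ∈ Set.Icc 0 xstar, q x = p x / g x v := fun x hx => by
      rw [hq, Set.IccExtend_of_mem _ _ hx]; rfl
    set Q : ℝ → ℝ := fun x => ∫ t in (0:ℝ)..x, q t with hQ
    have hQd : ∀ x, HasDerivAt Q (q x) x := fun x =>
      intervalIntegral.integral_hasDerivAt_right (hqcont.intervalIntegrable _ _)
        (hqcont.stronglyMeasurableAtFilter _ _) hqcont.continuousAt
    have hQC : ContDiff ℝ 1 Q := by
      rw [contDiff_one_iff_deriv]
      refine ⟨fun x => (hQd x).differentiableAt, ?_⟩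
      have : deriv Q = q := funext fun x => (hQd x).deriv
      rw [this]; exact hqcont
    set z : ℝ → ℝ := fun x => mu * v * Real.exp (Q x - Q xstar) with hz
    have hzC : ContDiff ℝ 1 z := contDiff_const.mul (hQC.sub contDiff_const).exp
    have hzpos : ∀ x, 0 < z x := fun x => by simp only [hz]; positivity
    have hzd : ∀ x, HasDerivAt z (q x * z x) x := fun x => by
      have := (((hQd x).sub_const (Q xstar)).exp).const_mul (mu * v)
      refine this.congr_deriv ?_
      simp only [hz]; ring
    refine ⟨z 0 / g 0 v, v, fun x => z x / g x v, div_pos (hzpos _) (hgpos _ h0m), hvpos,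
      fun x hx => div_pos (hzpos _) (hgpos _ hx), ?_, by rw [hv0, zero_mul], ?_, rfl, ?_⟩
    · exact hzC.contDiffOn.div (hgc.of_le (by norm_num)) (fun x hx => (hgpos x hx).ne')
    · intro x hx
      have h1 : HasDerivWithinAt z (p x * (z x / g x v)) (Set.Icc 0 xstar) x := by
        refine (hzd x).hasDerivWithinAt.congr_deriv ?_
        rw [hqe x hx]; ring
      have he : ∀ y ∈ Set.Icc 0 xstar, g y v * (z y / g y v) = z y := fun y hy =>
        mul_div_cancel₀ _ (hgpos y hy).ne'
      exact h1.congr he (he x hx)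
    · have := (hgpos _ hxm).ne'
      rw [mul_div_cancel₀ _ this]
      simp [hz]
  · intro wb vb wb' vb' ub ub' h h'
    have hv : vb = vb' := hαanti.injOn (Set.mem_Ici.mpr h.2.1.le) (Set.mem_Ici.mpr h'.2.1.le)
      ((key _ _ _ h).trans (key _ _ _ h').symm)
    subst hv
    obtain ⟨_, hvp, hu, _, _, hd, hw, he⟩ := h
    obtain ⟨_, _, hu', _, _, hd', hw', he'⟩ := h'
    have hgpos : ∀ x ∈ Set.Icc 0 xstar, 0 < g x vb := fun x hx =>
      lt_of_lt_of_le hgm (hgbound x hx vb hvp.le).1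
    have hD : ∀ x ∈ Set.Icc 0 xstar, HasDerivWithinAt
        (fun y => (g y vb * ub y) / (g y vb * ub' y)) 0 (Set.Icc 0 xstar) x := fun x hx => by
      have := (hd x hx).div (hd' x hx) (mul_pos (hgpos x hx) (hu' x hx)).ne'
      refine this.congr_deriv ?_
      rw [div_eq_zero_iff]; left; ring
    have hc := constant_of_derivWithin_zero (fun x hx => (hD x hx).differentiableWithinAt)
      (fun x hx => (hD x ⟨hx.1, hx.2.le⟩).derivWithin
        (uniqueDiffOn_Icc hxstar x ⟨hx.1, hx.2.le⟩))
    have hone : (g xstar vb * ub xstar) / (g xstar vb * ub' xstar) = 1 := by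
      rw [he, he']; exact div_self (mul_pos hmu hvp).ne'
    have heq : ∀ x ∈ Set.Icc 0 xstar, ub x = ub' x := fun x hx => by
      have h1 := (hc x hx).trans ((hc xstar hxm).symm.trans hone)
      have h2 := (div_eq_one_iff_eq (mul_pos (hgpos x hx) (hu' x hx)).ne').mp h1
      exact mul_left_cancel₀ (hgpos x hx).ne' h2
    exact ⟨by rw [← hw, ← hw']; exact heq 0 h0m, rfl, heq⟩
end

section
/- Assume the maturation rate g = g(x) does not depend on v, and let (w̄, ū, v̄) be a positive steady state of system (S) with α differentiable at v̄. If λ ∈ ℂ, λ ≠ 0, admits a nontrivial solution (W, U, V) of the linearized eigenvalue problem (λW = α'(v̄) w̄ V; λU(x) + d/dx[g(x)U(x)] = p(x)U(x); U(0) = W; λV = g(x*)U(x*) − μV), then λ satisfies λ² + μλ = μ v̄ α'(v̄) e^{−τλ}, where τ := ∫₀^{x*} dx / g(x) > 0. -/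
theorem characteristic_equation_g_independent_of_v
    (xstar mu : ℝ) (hxstar : 0 < xstar) (hmu : 0 < mu)
    (α : ℝ → ℝ) (g : ℝ → ℝ) (p : ℝ → ℝ)
    (hpcont : ContinuousOn p (Set.Icc 0 xstar))
    (hgcont : ContinuousOn g (Set.Icc 0 xstar))
    (gm gp : ℝ) (hgm : 0 < gm)
    (hgbound : ∀ x ∈ Set.Icc 0 xstar, g x ∈ Set.Icc gm gp)
    -- the positive steady state
    (wb vb : ℝ) (ub : ℝ → ℝ)
    (hwb : 0 < wb) (hvb : 0 < vb)
    (hubpos : ∀ x ∈ Set.Icc 0 xstar, 0 < ub x)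
    (hubC1 : ContDiffOn ℝ 1 ub (Set.Icc 0 xstar))
    (hαvb : α vb = 0)
    (hssu : ∀ x ∈ Set.Icc 0 xstar, HasDerivAt (fun y => g y * ub y) (p x * ub x) x)
    (hub0 : ub 0 = wb)
    (hssv : g xstar * ub xstar = mu * vb)
    -- α differentiable at vb
    (αp : ℝ) (hαp : HasDerivAt α αp vb)
    -- the eigenvalue λ and a nontrivial eigenfunction (W, U, V)
    (lam : ℂ) (hlam : lam ≠ 0)
    (W V : ℂ) (U : ℝ → ℂ)
    (hUC1 : ContDiffOn ℝ 1 U (Set.Icc 0 xstar))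
    (hE1 : lam * W = ((αp * wb : ℝ) : ℂ) * V)
    (hE2 : ∀ x ∈ Set.Icc 0 xstar,
      lam * U x + deriv (fun y => (g y : ℂ) * U y) x = (p x : ℂ) * U x)
    (hE3 : U 0 = W)
    (hE4 : lam * V = (g xstar : ℂ) * U xstar - (mu : ℂ) * V)
    (hnontriv : ¬ (W = 0 ∧ V = 0 ∧ ∀ x ∈ Set.Icc 0 xstar, U x = 0))
    :
    0 < (∫ x in (0:ℝ)..xstar, 1 / g x) ∧
    lam ^ 2 + (mu : ℂ) * lam
      = ((mu * vb * αp : ℝ) : ℂ)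
        * Complex.exp (-(((∫ x in (0:ℝ)..xstar, 1 / g x) : ℝ) : ℂ) * lam) := by
  have hg0 : ∀ x ∈ Set.Icc 0 xstar, 0 < g x := fun x hx => lt_of_lt_of_le hgm (hgbound x hx).1
  have hinv : ContinuousOn (fun x => 1 / g x) (Set.Icc 0 xstar) :=
    continuousOn_const.div hgcont (fun x hx => (hg0 x hx).ne')
  have hinvI : IntervalIntegrable (fun x => 1 / g x) MeasureTheory.volume 0 xstar :=
    hinv.intervalIntegrable_of_Icc hxstar.le
  have hpos : 0 < (∫ x in (0:ℝ)..xstar, 1 / g x) := by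
    apply intervalIntegral.intervalIntegral_pos_of_pos_on hinvI _ hxstar
    intro x hx
    exact one_div_pos.mpr (hg0 x (Set.Ioo_subset_Icc_self hx))
  refine ⟨hpos, ?_⟩
  set T : ℝ → ℝ := fun x => ∫ y in (0:ℝ)..x, 1 / g y with hT
  have hTcont : ContinuousOn T (Set.Icc 0 xstar) := by
    have := intervalIntegral.continuousOn_primitive_interval (μ := MeasureTheory.volume)
      (f := fun x => 1 / g x) (a := 0) (b := xstar)
      (by rw [Set.uIcc_of_le hxstar.le]; exact hinv.integrableOn_Icc)
    rwa [Set.uIcc_of_le hxstar.le] at this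
  have hTd : ∀ x ∈ Set.Ioo 0 xstar, HasDerivAt T (1 / g x) x := by
    intro x hx
    have hxn : Set.Icc 0 xstar ∈ nhds x := Icc_mem_nhds hx.1 hx.2
    apply intervalIntegral.integral_hasDerivAt_right
    · apply hinvI.mono_set
      rw [Set.uIcc_of_le hx.1.le, Set.uIcc_of_le hxstar.le]
      exact Set.Icc_subset_Icc_right hx.2.le
    · exact (hinv.mono Set.Ioo_subset_Icc_self).stronglyMeasurableAtFilter isOpen_Ioo x hx
    · exact hinv.continuousAt hxn
  let F : ℝ → ℂ := fun x => ((g x : ℂ) * U x) / ((g x * ub x : ℝ) : ℂ) * Complex.exp (lam * (T x : ℂ))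
  have hFc : ContinuousOn F (Set.Icc 0 xstar) := by
    have h1 : ContinuousOn (fun x => (g x : ℂ)) (Set.Icc 0 xstar) :=
      Complex.continuous_ofReal.comp_continuousOn hgcont
    have h2 : ContinuousOn (fun x => ((g x * ub x : ℝ) : ℂ)) (Set.Icc 0 xstar) :=
      Complex.continuous_ofReal.comp_continuousOn (hgcont.mul hubC1.continuousOn)
    have h3 : ContinuousOn (fun x => (T x : ℂ)) (Set.Icc 0 xstar) :=
      Complex.continuous_ofReal.comp_continuousOn hTcont
    refine ((h1.mul hUC1.continuousOn).div h2 ?_).mul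
      (Complex.continuous_exp.comp_continuousOn (continuousOn_const.mul h3))
    intro x hx
    exact_mod_cast (mul_pos (hg0 x hx) (hubpos x hx)).ne'
  have hFd : ∀ x ∈ Set.Ioo 0 xstar, HasDerivAt F 0 x := by
    intro x hx
    have hxI := Set.Ioo_subset_Icc_self hx
    have hxn : Set.Icc 0 xstar ∈ nhds x := Icc_mem_nhds hx.1 hx.2
    have hubd : DifferentiableAt ℝ ub x :=
      (hubC1.differentiableOn one_ne_zero).differentiableAt hxn
    have hUd : DifferentiableAt ℝ U x :=
      (hUC1.differentiableOn one_ne_zero).differentiableAt hxn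
    have hgd : DifferentiableAt ℝ g x := by
      have h := (hssu x hxI).differentiableAt.div hubd (hubpos x hxI).ne'
      refine h.congr_of_eventuallyEq ?_
      filter_upwards [hxn] with y hy
      have := (hubpos y hy).ne'
      simp [this]
    have hA : HasDerivAt (fun y => (g y : ℂ) * U y) ((p x : ℂ) * U x - lam * U x) x := by
      have h : DifferentiableAt ℝ (fun y => (g y : ℂ) * U y) x :=
        (hgd.hasDerivAt.ofReal_comp).differentiableAt.mul hUd
      have h' := h.hasDerivAt
      have e := hE2 x hxI
      rwa [show deriv (fun y => (g y : ℂ) * U y) x = (p x : ℂ) * U x - lam * U x by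
        rw [← e]; ring] at h'
    have hB := (hssu x hxI).ofReal_comp
    have hgne : (g x : ℂ) ≠ 0 := by exact_mod_cast (hg0 x hxI).ne'
    have hune : (ub x : ℂ) ≠ 0 := by exact_mod_cast (hubpos x hxI).ne'
    have hBne : ((g x * ub x : ℝ) : ℂ) ≠ 0 := by push_cast; exact mul_ne_zero hgne hune
    have hE := ((hTd x hx).ofReal_comp.const_mul lam).cexp
    refine ((hA.div hB hBne).mul hE).congr_deriv ?_
    simp only [Pi.div_apply]
    push_cast
    field_simp
    ring
  have key : ∀ x ∈ Set.Icc 0 xstar, F x = F 0 := by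
    intro x hx
    have h := intervalIntegral.integral_eq_sub_of_hasDerivAt_of_le hx.1
      (hFc.mono (Set.Icc_subset_Icc_right hx.2))
      (fun y hy => hFd y ⟨hy.1, hy.2.trans_le hx.2⟩) (by simp)
    simp only [intervalIntegral.integral_zero] at h
    exact (sub_eq_zero.mp h.symm)
  have h0 : (0:ℝ) ∈ Set.Icc 0 xstar := ⟨le_rfl, hxstar.le⟩
  have h1 : xstar ∈ Set.Icc 0 xstar := ⟨hxstar.le, le_rfl⟩
  have hwne : (wb : ℂ) ≠ 0 := by exact_mod_cast hwb.ne'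
  have hF0 : F 0 = W / wb := by
    have : (g 0 : ℂ) ≠ 0 := by exact_mod_cast (hg0 0 h0).ne'
    simp only [F, hT, hE3, hub0]
    simp
    field_simp
  have hUx : ∀ x ∈ Set.Icc 0 xstar, U x = ub x * (W / wb) * Complex.exp (-(T x : ℂ) * lam) := by
    intro x hx
    have hgne : (g x : ℂ) ≠ 0 := by exact_mod_cast (hg0 x hx).ne'
    have hune : (ub x : ℂ) ≠ 0 := by exact_mod_cast (hubpos x hx).ne'
    rw [← hF0, ← key x hx]
    simp only [F]
    have : Complex.exp (lam * (T x : ℂ)) * Complex.exp (-(T x : ℂ) * lam) = 1 := by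
      rw [← Complex.exp_add]; simp [mul_comm]
    push_cast
    calc U x = U x * (Complex.exp (lam * (T x : ℂ)) * Complex.exp (-(T x : ℂ) * lam)) := by
          rw [this, mul_one]
      _ = _ := by field_simp
  have hV : V ≠ 0 := by
    intro hV
    have hW : W = 0 := by
      rw [hV, mul_zero] at hE1
      exact (mul_eq_zero.mp hE1).resolve_left hlam
    exact hnontriv ⟨hW, hV, fun x hx => by rw [hUx x hx, hW]; simp⟩
  have hs : (g xstar : ℂ) * ub xstar = mu * vb := by exact_mod_cast hssv
  have e := hUx xstar h1
  change _ = _ * Complex.exp (-(T xstar : ℂ) * lam)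
  generalize Complex.exp (-(T xstar : ℂ) * lam) = E at e ⊢
  rw [e] at hE4
  have h4 : lam * V + mu * V = mu * vb * (W / wb) * E := by
    rw [hE4, ← hs]; ring
  have h5 : lam * (W / wb) = αp * V := by
    rw [← mul_div_assoc, hE1]; push_cast; field_simp
  apply mul_right_cancel₀ hV
  push_cast
  linear_combination lam * h4 + mu * vb * E * h5
end

section
/- Let τ > 0, v̄ > 0, β > 0, and set A := τ v̄ β. If 1 < A < π/2, then: (a) there is a unique ω > 0 satisfying τω = A sin(τω), and it satisfies τω ∈ (0, π/2), so cos(τω) > 0; (b) consequently there is exactly one μ₀ > 0 such that the characteristic equation λ² + μ₀ λ = −μ₀ v̄ β e^{−τλ} admits a purely imaginary nonzero root λ = iω' with ω' > 0, namely μ₀ = ω² / ( v̄ β cos(τω) ) with ω' = ω. -/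
lemma aux_unique (A x y : ℝ) (hA : 0 < A) (hA2 : A < Real.pi / 2) (hx : 0 < x) (hxy : x < y)
    (h1 : x = A * Real.sin x) (h2 : y = A * Real.sin y) : False := by
  have hpi := Real.pi_pos
  have hy : 0 < y := hx.trans hxy
  have hyA : y ≤ A := by nlinarith [Real.sin_le_one y]
  have hym : y ∈ Set.Icc 0 Real.pi := ⟨hy.le, by linarith⟩
  have h0m : (0:ℝ) ∈ Set.Icc 0 Real.pi := ⟨le_rfl, hpi.le⟩
  have ha : 0 < x / y := by positivity
  have hb : 0 < 1 - x / y := by rw [sub_pos, div_lt_one hy]; exact hxy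
  have h := strictConcaveOn_sin_Icc.2 hym h0m hy.ne' ha hb (by ring)
  simp only [smul_eq_mul, mul_zero, add_zero, Real.sin_zero] at h
  rw [div_mul_cancel₀ _ hy.ne'] at h
  have h3 := mul_lt_mul_of_pos_left h hA
  rw [← h1] at h3
  have h4 : A * (x / y * Real.sin y) = x := by
    calc A * (x / y * Real.sin y) = x / y * (A * Real.sin y) := by ring
      _ = x / y * y := by rw [← h2]
      _ = x := div_mul_cancel₀ _ hy.ne'
  linarith

lemma aux_exists (A : ℝ) (hA : 1 < A) (hA2 : A < Real.pi / 2) :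
    ∃ x, 0 < x ∧ x < Real.pi / 2 ∧ x = A * Real.sin x := by
  have hA0 : 0 < A := by linarith
  have hd0 : 0 < 1 - 1 / A := by rw [sub_pos, div_lt_one hA0]; exact hA
  have hinv : 0 < 1 / A := by positivity
  obtain ⟨d, hd⟩ : ∃ d, d = 1 - 1 / A := ⟨_, rfl⟩
  have hAd : A * d = A - 1 := by rw [hd]; field_simp
  rw [← hd] at hd0
  have hd1 : d < 1 := by linarith
  have hs := Real.sin_gt_sub_cube hd0
  have hf0 : d ≤ A * Real.sin d := by
    have h1 : A * (d - d ^ 3 / 6) ≤ A * Real.sin d := mul_le_mul_of_nonneg_left hs.le hA0.le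
    have h2 : A * (d - d ^ 3 / 6) = A * d - (A * d) * d ^ 2 / 6 := by ring
    have h3 : d * (A * (1 - d ^ 2 / 6)) = A * (d - d ^ 3 / 6) := by ring
    have h4 : 1 ≤ A * (1 - d ^ 2 / 6) := by nlinarith
    nlinarith
  have hc : ContinuousOn (fun x => A * Real.sin x - x) (Set.Icc d (Real.pi / 2)) := by fun_prop
  have hp := intermediate_value_Icc' (by linarith : d ≤ Real.pi / 2) hc
  obtain ⟨x, hx, hx2⟩ := hp (show (0:ℝ) ∈ _ from
    ⟨by simp only [Real.sin_pi_div_two]; linarith, by linarith⟩)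
  simp only at hx2
  have hxA : x ≤ A := by nlinarith [Real.sin_le_one x]
  exact ⟨x, by linarith [hx.1], by linarith, by linarith⟩

lemma aux_char (τ vb β μ w : ℝ) :
    ((Complex.I * (w : ℂ)) ^ 2 + (μ : ℂ) * (Complex.I * (w : ℂ))
      = -((μ * vb * β : ℝ) : ℂ) * Complex.exp (-(τ : ℂ) * (Complex.I * (w : ℂ)))) ↔
    (w ^ 2 = μ * vb * β * Real.cos (τ * w) ∧ μ * w = μ * vb * β * Real.sin (τ * w)) := by
  have he : Complex.exp (-(τ : ℂ) * (Complex.I * (w : ℂ)))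
      = (Real.cos (τ * w) : ℂ) - (Real.sin (τ * w) : ℂ) * Complex.I := by
    have : -(τ : ℂ) * (Complex.I * (w : ℂ)) = ((-(τ * w) : ℝ) : ℂ) * Complex.I := by
      push_cast; ring
    rw [this, Complex.exp_mul_I, ← Complex.ofReal_cos, ← Complex.ofReal_sin, Real.cos_neg,
      Real.sin_neg]
    push_cast; ring
  have hl : (Complex.I * (w : ℂ)) ^ 2 + (μ : ℂ) * (Complex.I * (w : ℂ))
      = ((-w ^ 2 : ℝ) : ℂ) + ((μ * w : ℝ) : ℂ) * Complex.I := by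
    push_cast; rw [mul_pow, Complex.I_sq]; ring
  have hr : -((μ * vb * β : ℝ) : ℂ) * ((Real.cos (τ * w) : ℂ) - (Real.sin (τ * w) : ℂ) * Complex.I)
      = ((-(μ * vb * β * Real.cos (τ * w)) : ℝ) : ℂ)
        + ((μ * vb * β * Real.sin (τ * w) : ℝ) : ℂ) * Complex.I := by
    push_cast; ring
  rw [he, hl, hr, Complex.ext_iff]
  simp only [Complex.add_re, Complex.add_im, Complex.re_ofReal_mul, Complex.im_ofReal_mul,
    Complex.ofReal_re, Complex.ofReal_im, Complex.I_re, Complex.I_im, mul_zero, add_zero, zero_add,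
    mul_one, neg_inj]

theorem hopf_bifurcation_single
    (τ vb β : ℝ) (hτ : 0 < τ) (hvb : 0 < vb) (hβ : 0 < β)
    (hA1 : 1 < τ * vb * β) (hA2 : τ * vb * β < Real.pi / 2)
    :
    ∃ ω : ℝ, 0 < ω
      ∧ τ * ω = τ * vb * β * Real.sin (τ * ω)
      ∧ τ * ω ∈ Set.Ioo 0 (Real.pi / 2)
      ∧ 0 < Real.cos (τ * ω)
      ∧ (∀ ω' > (0:ℝ), τ * ω' = τ * vb * β * Real.sin (τ * ω') → ω' = ω)
      ∧ 0 < ω ^ 2 / (vb * β * Real.cos (τ * ω))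
      ∧ (Complex.I * (ω : ℂ)) ^ 2
          + ((ω ^ 2 / (vb * β * Real.cos (τ * ω)) : ℝ) : ℂ) * (Complex.I * (ω : ℂ))
        = -((ω ^ 2 / (vb * β * Real.cos (τ * ω)) * vb * β : ℝ) : ℂ)
            * Complex.exp (-(τ : ℂ) * (Complex.I * (ω : ℂ)))
      ∧ (∀ μ' > (0:ℝ),
          (∃ ω' > (0:ℝ),
            (Complex.I * (ω' : ℂ)) ^ 2 + (μ' : ℂ) * (Complex.I * (ω' : ℂ))
              = -((μ' * vb * β : ℝ) : ℂ) * Complex.exp (-(τ : ℂ) * (Complex.I * (ω' : ℂ)))) →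
          μ' = ω ^ 2 / (vb * β * Real.cos (τ * ω))) := by
  obtain ⟨x, hx0, hx1, hx⟩ := aux_exists _ hA1 hA2
  have hA0 : 0 < τ * vb * β := by positivity
  have hxt : τ * (x / τ) = x := mul_div_cancel₀ _ hτ.ne'
  obtain ⟨ω, hω⟩ : ∃ ω, ω = x / τ := ⟨_, rfl⟩
  rw [← hω] at hxt
  have hω0 : 0 < ω := by rw [hω]; positivity
  rw [← hxt] at hx hx0 hx1
  have hcos : 0 < Real.cos (τ * ω) := Real.cos_pos_of_mem_Ioo ⟨by linarith, hx1⟩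
  have huniq : ∀ ω' > (0:ℝ), τ * ω' = τ * vb * β * Real.sin (τ * ω') → ω' = ω := by
    intro w hw h
    have hw0 : 0 < τ * w := by positivity
    rcases lt_trichotomy (τ * w) (τ * ω) with hlt | heq | hlt
    · exact (aux_unique _ _ _ hA0 hA2 hw0 hlt h hx).elim
    · exact mul_left_cancel₀ hτ.ne' heq
    · exact (aux_unique _ _ _ hA0 hA2 hx0 hlt hx h).elim
  refine ⟨ω, hω0, hx, ⟨hx0, hx1⟩, hcos, huniq, by positivity, ?_, ?_⟩
  · rw [aux_char]
    have hs : ω = vb * β * Real.sin (τ * ω) := by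
      apply mul_left_cancel₀ hτ.ne'
      linarith
    constructor
    · have hc := hcos.ne'
      generalize Real.cos (τ * ω) = c at hc
      field_simp
    · generalize ω ^ 2 / (vb * β * Real.cos (τ * ω)) = m
      calc m * ω = m * (vb * β * Real.sin (τ * ω)) := by rw [← hs]
        _ = _ := by ring
  · rintro m hm ⟨w, hw, h⟩
    rw [aux_char] at h
    obtain ⟨h1, h2⟩ := h
    have hs : w = vb * β * Real.sin (τ * w) := by
      apply mul_left_cancel₀ hm.ne'
      linarith
    have hww : w = ω := huniq w hw (by
      calc τ * w = τ * (vb * β * Real.sin (τ * w)) := by rw [← hs]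
        _ = _ := by ring)
    subst hww
    rw [eq_div_iff (by positivity)]
    linarith
end

section
/- Let τ > 0, v̄ > 0, β > 0, set A := τ v̄ β, and let k ≥ 1 be an integer. If A > 2kπ + π/2, then there exists ω > 0 with τω ∈ (2kπ, 2kπ + π/2) satisfying τω = A sin(τω); for any such ω one has cos(τω) > 0, and μ_k := ω² / ( v̄ β cos(τω) ) > 0 is such that λ = iω is a root of the characteristic equation λ² + μ_k λ = −μ_k v̄ β e^{−τλ}. -/
theorem hopf_bifurcation_further
    (τ vb β : ℝ) (hτ : 0 < τ) (hvb : 0 < vb) (hβ : 0 < β)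
    (k : ℕ) (hk : 1 ≤ k)
    (hA : 2 * (k : ℝ) * Real.pi + Real.pi / 2 < τ * vb * β)
    :
    (∃ ω > (0:ℝ),
      τ * ω ∈ Set.Ioo (2 * (k : ℝ) * Real.pi) (2 * (k : ℝ) * Real.pi + Real.pi / 2)
      ∧ τ * ω = τ * vb * β * Real.sin (τ * ω))
    ∧ ∀ ω > (0:ℝ),
        τ * ω ∈ Set.Ioo (2 * (k : ℝ) * Real.pi) (2 * (k : ℝ) * Real.pi + Real.pi / 2) →
        τ * ω = τ * vb * β * Real.sin (τ * ω) →
        0 < Real.cos (τ * ω)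
        ∧ 0 < ω ^ 2 / (vb * β * Real.cos (τ * ω))
        ∧ (Complex.I * (ω : ℂ)) ^ 2
            + ((ω ^ 2 / (vb * β * Real.cos (τ * ω)) : ℝ) : ℂ) * (Complex.I * (ω : ℂ))
          = -((ω ^ 2 / (vb * β * Real.cos (τ * ω)) * vb * β : ℝ) : ℂ)
              * Complex.exp (-(τ : ℂ) * (Complex.I * (ω : ℂ))) := by
  have hk' : (1 : ℝ) ≤ k := by exact_mod_cast hk
  have hpi := Real.pi_pos
  have hkpi : 0 < 2 * (k : ℝ) * Real.pi := by positivity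
  constructor
  · have hcont : ContinuousOn (fun x : ℝ => τ * vb * β * Real.sin x - x)
        (Set.Icc (2 * (k : ℝ) * Real.pi) (2 * (k : ℝ) * Real.pi + Real.pi / 2)) := by
      fun_prop
    have s0 : Real.sin (2 * (k : ℝ) * Real.pi) = 0 := by
      have := Real.sin_nat_mul_pi (2 * k)
      push_cast at this
      exact this
    have s1 : Real.sin (2 * (k : ℝ) * Real.pi + Real.pi / 2) = 1 := by
      rw [Real.sin_add_pi_div_two]
      have := Real.cos_nat_mul_two_pi k
      rw [← this]
      ring_nf
    have h := intermediate_value_Ioo (by linarith) hcont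
    have h0 : (0 : ℝ) ∈ Set.Ioo
        (τ * vb * β * Real.sin (2 * (k : ℝ) * Real.pi) - 2 * (k : ℝ) * Real.pi)
        (τ * vb * β * Real.sin (2 * (k : ℝ) * Real.pi + Real.pi / 2)
          - (2 * (k : ℝ) * Real.pi + Real.pi / 2)) := by
      rw [s0, s1]
      constructor <;> linarith
    obtain ⟨x, hx, hx0⟩ := h h0
    have hx0' : τ * vb * β * Real.sin x - x = 0 := hx0
    have e : τ * (x / τ) = x := by field_simp
    refine ⟨x / τ, div_pos (hkpi.trans hx.1) hτ, ?_, ?_⟩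
    · rw [e]; exact hx
    · rw [e]; linarith
  · intro ω hω hmem heq
    have hc : 0 < Real.cos (τ * ω) := by
      rw [← Real.cos_sub_nat_mul_two_pi (τ * ω) k]
      apply Real.cos_pos_of_mem_Ioo
      constructor <;> linarith [hmem.1, hmem.2]
    refine ⟨hc, by positivity, ?_⟩
    have hs : ω = vb * β * Real.sin (τ * ω) := by
      apply mul_left_cancel₀ hτ.ne'
      linarith
    have hm : ω ^ 2 / (vb * β * Real.cos (τ * ω)) * vb * β * Real.cos (τ * ω) = ω ^ 2 := by
      rw [mul_assoc, mul_assoc, ← mul_assoc vb]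
      exact div_mul_cancel₀ _ (by positivity)
    generalize ω ^ 2 / (vb * β * Real.cos (τ * ω)) = m at hm ⊢
    have he : Complex.exp (-(τ : ℂ) * (Complex.I * (ω : ℂ)))
        = (Real.cos (τ * ω) : ℂ) - (Real.sin (τ * ω) : ℂ) * Complex.I := by
      have : -(τ : ℂ) * (Complex.I * (ω : ℂ)) = (-((τ * ω : ℝ) : ℂ)) * Complex.I := by
        push_cast; ring
      rw [this, Complex.exp_mul_I, Complex.cos_neg, Complex.sin_neg, ← Complex.ofReal_cos,
        ← Complex.ofReal_sin]
      ring
    rw [he]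
    generalize Real.cos (τ * ω) = c at *
    generalize Real.sin (τ * ω) = s at *
    have hs' : (ω : ℂ) = vb * β * s := by exact_mod_cast hs
    have hm' : (m : ℂ) * vb * β * c = ω ^ 2 := by exact_mod_cast hm
    push_cast
    linear_combination (ω : ℂ) ^ 2 * Complex.I_sq + (m : ℂ) * Complex.I * hs' + hm'
end

section
/- Let a_w ∈ (1/2, 1], p_w > 0, μ > 0, x* > 0. Then every λ ∈ ℂ, λ ≠ 0, satisfying λ + μ/(2a_w) = −( μ(2a_w − 1)/(2a_w) ) · ( p_w/λ + ∫₀^{x*} e^{λx/p_w} dx ) · e^{−λ x*/p_w} has Re λ < 0. (Equivalently, λ satisfies λ² + Cλ + D = 0 with C = μ/(2a_w) > 0 and D = p_w μ (2a_w − 1)/(2a_w) > 0, hence Re λ < 0.) -/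
theorem stability_constant_proliferation
    (aw pw mu xstar : ℝ) (haw : aw ∈ Set.Ioc (1/2 : ℝ) 1)
    (hpw : 0 < pw) (hmu : 0 < mu) (hxstar : 0 < xstar)
    :
    ∀ lam : ℂ, lam ≠ 0 →
      lam + ((mu / (2 * aw) : ℝ) : ℂ)
        = -((mu * (2 * aw - 1) / (2 * aw) : ℝ) : ℂ)
            * ((pw : ℂ) / lam + ∫ x in (0:ℝ)..xstar, Complex.exp (lam * (x : ℂ) / (pw : ℂ)))
            * Complex.exp (-lam * (xstar : ℂ) / (pw : ℂ)) →
      lam.re < 0 := by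
  intro lam hlam h
  obtain ⟨ha, _⟩ := haw
  have hpc : (pw : ℂ) ≠ 0 := by exact_mod_cast hpw.ne'
  have hC : 0 < mu / (2 * aw) := by
    apply div_pos hmu; linarith
  have hD : 0 < mu * (2 * aw - 1) / (2 * aw) := by
    apply div_pos (mul_pos hmu _) <;> linarith
  generalize mu / (2 * aw) = C at h hC
  generalize mu * (2 * aw - 1) / (2 * aw) = D at h hD
  have hint : ∫ x in (0:ℝ)..xstar, Complex.exp (lam * (x : ℂ) / (pw : ℂ))
      = (Complex.exp (lam / pw * xstar) - 1) / (lam / pw) := by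
    have h1 := integral_exp_mul_complex (a := 0) (b := xstar) (div_ne_zero hlam hpc)
    rw [Complex.ofReal_zero, mul_zero, Complex.exp_zero] at h1
    rw [← h1]
    congr 1
    funext x
    congr 1
    ring
  have hexp : Complex.exp (lam / pw * xstar) * Complex.exp (-lam * (xstar : ℂ) / (pw : ℂ)) = 1 := by
    rw [← Complex.exp_add, ← Complex.exp_zero]
    congr 1
    ring
  rw [hint] at h
  have hsum : (pw : ℂ) / lam + (Complex.exp (lam / pw * xstar) - 1) / (lam / pw)
      = pw / lam * Complex.exp (lam / pw * xstar) := by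
    rw [div_div_eq_mul_div]
    ring
  rw [hsum, mul_assoc, mul_assoc, hexp, mul_one] at h
  have hq : lam * lam + C * lam + D * pw = 0 := by
    have h2 : (lam + C) * lam = -(D : ℂ) * (pw / lam) * lam := by rw [h]
    rw [mul_assoc, div_mul_cancel₀ _ hlam] at h2
    linear_combination h2
  have hre := congrArg Complex.re hq
  have him := congrArg Complex.im hq
  simp at hre him
  have hDp := mul_pos hD hpw
  by_contra! hn
  have hb : lam.im * (2 * lam.re + C) = 0 := by linarith
  rcases mul_eq_zero.mp hb with hb | hb
  · rw [hb] at hre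
    nlinarith [mul_nonneg hC.le hn, mul_self_nonneg lam.re]
  · linarith
end

section
/- Let a_w ∈ (1/2, 1], B > 0, p_w > 0, and let ω > 0 satisfy ω / ( p_w (2a_w − 1) B ) ≤ 1. Then there exist ℓ > 0 and μ > 0 such that ω/p_w = −(2a_w − 1) B sin( ωℓ/p_w ) and ( ω²/p_w² ) · ( 2a_w/(2a_w − 1) ) = ( μ/p_w ) ( 1 + B ( 1 − cos( ωℓ/p_w ) ) ). Consequently, for any x* ≥ ℓ and y* := x* − ℓ, λ = iω is a purely imaginary root of the characteristic equation λ² + Cλ + D = −( μ(2a_w − 1)/(2a_w) ) λ ∫₀^{x*} b(x) e^{λ(x−x*)/p_w} dx with C = μ/(2a_w), D = p_w μ (2a_w − 1)/(2a_w) and b(x) = B·𝟙_{[y*, x*]}(x). -/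
open MeasureTheory in
theorem aux_integral (B pw ω l X : ℝ) (hpw : 0 < pw) (hω : 0 < ω) (hl : 0 < l) (hX : l ≤ X) :
    Complex.I * (ω : ℂ) * (∫ x in (0:ℝ)..X,
      ((Set.indicator (Set.Icc (X - l) X) (fun _ => B) x : ℝ) : ℂ)
        * Complex.exp (Complex.I * (ω : ℂ) * ((x : ℂ) - (X : ℂ)) / (pw : ℂ)))
    = B * pw * (1 - Complex.exp (-((ω * l / pw : ℝ) : ℂ) * Complex.I)) := by
  have hp : (pw : ℂ) ≠ 0 := by exact_mod_cast hpw.ne'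
  have hw : (ω : ℂ) ≠ 0 := by exact_mod_cast hω.ne'
  have h1 : (∫ x in (0:ℝ)..X,
      ((Set.indicator (Set.Icc (X - l) X) (fun _ => B) x : ℝ) : ℂ)
        * Complex.exp (Complex.I * (ω : ℂ) * ((x : ℂ) - (X : ℂ)) / (pw : ℂ)))
      = ∫ x in (X - l)..X, (B : ℂ) *
          Complex.exp (Complex.I * (ω : ℂ) * ((x : ℂ) - (X : ℂ)) / (pw : ℂ)) := by
    rw [intervalIntegral.integral_of_le (by linarith), intervalIntegral.integral_of_le (by linarith)]
    have hs : Set.Ioc (X - l) X = Set.Ioc 0 X ∩ Set.Ioc (X - l) X := by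
      ext x
      simp only [Set.mem_inter_iff, Set.mem_Ioc]
      constructor
      · rintro ⟨h, h'⟩
        exact ⟨⟨by linarith, h'⟩, h, h'⟩
      · exact fun h => h.2
    rw [hs, ← setIntegral_indicator measurableSet_Ioc]
    apply integral_congr_ae
    apply ae_restrict_of_ae
    have hne : ∀ᵐ x : ℝ, x ≠ X - l := by
      simp [ae_iff]
    filter_upwards [hne] with x hx
    by_cases h : x ∈ Set.Ioc (X - l) X
    · rw [Set.indicator_of_mem h, Set.indicator_of_mem (Set.Ioc_subset_Icc_self h)]
    · have h' : x ∉ Set.Icc (X - l) X := fun h' => h ⟨lt_of_le_of_ne h'.1 (Ne.symm hx), h'.2⟩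
      rw [Set.indicator_of_notMem h, Set.indicator_of_notMem h']
      simp
  have hc : Complex.I * (ω : ℂ) / pw ≠ 0 := div_ne_zero (mul_ne_zero Complex.I_ne_zero hw) hp
  have hd : ∀ x ∈ Set.uIcc (X - l) X, HasDerivAt (fun x : ℝ => (B : ℂ) * pw / (Complex.I * ω) *
      Complex.exp (Complex.I * (ω : ℂ) * ((x : ℂ) - (X : ℂ)) / (pw : ℂ)))
      ((B : ℂ) * Complex.exp (Complex.I * (ω : ℂ) * ((x : ℂ) - (X : ℂ)) / (pw : ℂ))) x := by
    intro x _
    have h := ((((((hasDerivAt_id (x : ℂ)).sub_const (X : ℂ)).const_mul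
      (Complex.I * (ω : ℂ))).div_const (pw : ℂ)).cexp).const_mul
      ((B : ℂ) * pw / (Complex.I * ω))).comp_ofReal
    simp only [id] at h
    convert h using 1
    field_simp [Complex.I_ne_zero]
  rw [h1, intervalIntegral.integral_eq_sub_of_hasDerivAt hd
    (Continuous.intervalIntegrable (by fun_prop) _ _)]
  have e1 : Complex.I * (ω : ℂ) * ((X : ℂ) - X) / pw = 0 := by simp
  have e2 : Complex.I * (ω : ℂ) * (((X - l : ℝ) : ℂ) - X) / pw
      = -((ω * l / pw : ℝ) : ℂ) * Complex.I := by push_cast; ring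
  rw [e1, e2, Complex.exp_zero]
  field_simp [Complex.I_ne_zero]

theorem instability_example
    (aw B pw ω : ℝ) (haw : aw ∈ Set.Ioc (1/2 : ℝ) 1)
    (hB : 0 < B) (hpw : 0 < pw) (hω : 0 < ω)
    (hcond : ω / (pw * (2 * aw - 1) * B) ≤ 1)
    :
    ∃ l > (0:ℝ), ∃ mu > (0:ℝ),
      ω / pw = -(2 * aw - 1) * B * Real.sin (ω * l / pw)
      ∧ ω ^ 2 / pw ^ 2 * (2 * aw / (2 * aw - 1))
          = mu / pw * (1 + B * (1 - Real.cos (ω * l / pw)))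
      ∧ ∀ xstar ≥ l,
          (Complex.I * (ω : ℂ)) ^ 2
            + ((mu / (2 * aw) : ℝ) : ℂ) * (Complex.I * (ω : ℂ))
            + ((pw * mu * (2 * aw - 1) / (2 * aw) : ℝ) : ℂ)
          = -((mu * (2 * aw - 1) / (2 * aw) : ℝ) : ℂ) * (Complex.I * (ω : ℂ))
              * ∫ x in (0:ℝ)..xstar,
                  ((Set.indicator (Set.Icc (xstar - l) xstar) (fun _ => B) x : ℝ) : ℂ)
                  * Complex.exp (Complex.I * (ω : ℂ) * ((x : ℂ) - (xstar : ℂ)) / (pw : ℂ)) := by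
  obtain ⟨ha1, ha2⟩ := haw
  have hc : 0 < 2 * aw - 1 := by linarith
  have ha : 0 < aw := by linarith
  have hden : 0 < pw * (2 * aw - 1) * B := by positivity
  set s := ω / (pw * (2 * aw - 1) * B) with hs
  have hs0 : 0 < s := by positivity
  have hθ0 : 0 < Real.pi + Real.arcsin s :=
    add_pos_of_pos_of_nonneg Real.pi_pos (Real.arcsin_nonneg.2 hs0.le)
  set θ := Real.pi + Real.arcsin s with hθ
  have hsin : Real.sin θ = -s := by
    rw [hθ, add_comm, Real.sin_add_pi, Real.sin_arcsin (by linarith) hcond]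
  have hK : 0 < 1 + B * (1 - Real.cos θ) := by
    have := mul_nonneg hB.le (sub_nonneg.2 (Real.cos_le_one θ))
    linarith
  have hl : ω * (pw * θ / ω) / pw = θ := by field_simp
  have key1 : ω = -(2 * aw - 1) * B * pw * Real.sin θ := by
    rw [hsin, hs]; field_simp
  refine ⟨pw * θ / ω, by positivity,
    ω ^ 2 / pw * (2 * aw / (2 * aw - 1)) / (1 + B * (1 - Real.cos θ)), by positivity, ?_, ?_, ?_⟩
  · rw [hl, hsin, hs]; field_simp
  · rw [hl]; field_simp
  intro X hX
  set mu := ω ^ 2 / pw * (2 * aw / (2 * aw - 1)) / (1 + B * (1 - Real.cos θ)) with hmu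
  have key2 : ω ^ 2 = pw * mu * (2 * aw - 1) / (2 * aw) * (1 + B * (1 - Real.cos θ)) := by
    rw [hmu]; field_simp
  rw [mul_assoc (-_) (Complex.I * (ω : ℂ)), aux_integral B pw ω _ X hpw hω (by positivity) hX, hl,
    Complex.exp_mul_I, Complex.cos_neg, Complex.sin_neg, ← Complex.ofReal_cos, ← Complex.ofReal_sin]
  have k1 : mu / (2 * aw) * ω = -(mu * (2 * aw - 1) / (2 * aw)) * (B * pw * Real.sin θ) := by
    linear_combination mu / (2 * aw) * key1
  have k2 : -ω ^ 2 + pw * mu * (2 * aw - 1) / (2 * aw)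
      = -(mu * (2 * aw - 1) / (2 * aw)) * (B * pw * (1 - Real.cos θ)) := by
    linear_combination -key2
  have c1 := congrArg (fun x : ℝ => (x : ℂ)) k1
  have c2 := congrArg (fun x : ℝ => (x : ℂ)) k2
  simp only [Complex.ofReal_mul, Complex.ofReal_neg, Complex.ofReal_add, Complex.ofReal_sub,
    Complex.ofReal_pow, Complex.ofReal_div, Complex.ofReal_one, Complex.ofReal_ofNat] at c1 c2 ⊢
  linear_combination Complex.I * c1 + c2 + (ω : ℂ) ^ 2 * Complex.I_sq
end
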